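/- arXiv:1102.5574 — 9 statements merged into one kernel-verified Lean document; each statement's English description precedes it below -/
import Mathlib

section
/- Let p_1, ..., p_n be distinct primes, let α_1 ≥ α_2 ≥ ... ≥ α_u > α_{u+1} = ... = α_n ≥ 2 (with u = 0 if all α_i are equal), and let N = p_1^{α_1}···p_n^{α_n}. For a set D of positive divisors of N, the following three statements are equivalent: (a) D is a maximal N-set of minimum size (i.e. |D| = α_n · ∏_{i=1}^{n-1} (α_i + 1)); (b) D is a maximal N-set with d(D) = {p_v} for some v with u+1 ≤ v ≤ n; (c) D = { d : d ∣ N, p_v ∣ d } for some v with u+1 ≤ v ≤ n. -/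
open Finset

/-- `D` is an `N`-set: a set of positive divisors of `N`, no two elements of which
are coprime. -/
def IsNSet (N : ℕ) (D : Finset ℕ) : Prop :=
  (∀ d ∈ D, d ∣ N) ∧ (∀ d ∈ D, ∀ e ∈ D, Nat.gcd d e ≠ 1)

/-- An `N`-set `D` is maximal if no further divisor of `N` can be added while keeping
the property that no two elements are coprime. -/
def IsMaxNSet (N : ℕ) (D : Finset ℕ) : Prop :=
  IsNSet N D ∧ ∀ l, l ∣ N → l ∉ D → ∃ d ∈ D, Nat.gcd l d = 1

/-- `dSet D` is the set of divisible minimal elements of `D`: those elements of `D`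
not divisible by any other element of `D`. -/
def dSet (D : Finset ℕ) : Finset ℕ :=
  D.filter fun d => ∀ e ∈ D, e ∣ d → e = d

/-- `RSet T N` is `R(T, N)`: the set of positive divisors of `N` divisible by at least
one element of `T`. -/
def RSet (T : Finset ℕ) (N : ℕ) : Finset ℕ :=
  N.divisors.filter fun l => ∃ t ∈ T, t ∣ l

section ExponentVectors

variable {ι : Type*} {α : ι → ℕ}

/-- `S` is a maximal family of exponent vectors any two of which share a nonzero coordinate. -/
def IsMaxIntersecting (S : Set (∀ i, ZMod (α i + 1))) : Prop :=
  ∀ x, x ∈ S ↔ ∀ y ∈ S, ∃ i, x i ≠ 0 ∧ y i ≠ 0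

namespace IsMaxIntersecting

variable {S : Set (∀ i, ZMod (α i + 1))}

lemma mem_of_notMem (hS : IsMaxIntersecting S) {x y : ∀ i, ZMod (α i + 1)} (hx : x ∉ S)
    (hxy : ∀ i, x i = 0 → y i ≠ 0) : y ∈ S := by
  rw [hS] at hx ⊢
  push Not at hx
  obtain ⟨e, he, hex⟩ := hx
  intro z hz
  obtain ⟨i, hei, hzi⟩ := (hS e).1 he z hz
  exact ⟨i, hxy i (by_contra fun h => hei (hex i h)), hzi⟩

lemma mem_of_support_subset (hS : IsMaxIntersecting S) {x y : ∀ i, ZMod (α i + 1)} (hx : x ∈ S)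
    (hxy : ∀ i, x i ≠ 0 → y i ≠ 0) : y ∈ S := by
  rw [hS] at hx ⊢
  intro z hz
  obtain ⟨i, hxi, hzi⟩ := hx z hz
  exact ⟨i, hxy i hxi, hzi⟩

end IsMaxIntersecting

lemma ZMod.natCast_injOn_le {a m : ℕ} (h : m ≤ a) {c d : ℕ} (hc : c ≤ m) (hd : d ≤ m)
    (hcd : (c : ZMod (a + 1)) = d) : c = d := by
  rw [ZMod.natCast_eq_natCast_iff', Nat.mod_eq_of_lt (by omega), Nat.mod_eq_of_lt (by omega)] at hcd
  exact hcd

lemma IsMaxIntersecting.exists_add_notMem [Fintype ι] [DecidableEq ι]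
    {S : Finset (∀ i, ZMod (α i + 1))} (hS : IsMaxIntersecting (S : Set (∀ i, ZMod (α i + 1))))
    {m : ℕ} (hm : ∀ i, m ≤ α i)
    (hcard : (m + 1) * (univ \ S).card = ∏ i, (α i + 1))
    (x : ∀ i, ZMod (α i + 1)) : ∃ c ≤ m, (fun i => x i + (c : ZMod (α i + 1))) ∉ S := by
  let s (c : ℕ) (x : ∀ i, ZMod (α i + 1)) : ∀ i, ZMod (α i + 1) := fun i => x i + c
  let f (x : ∀ i, ZMod (α i + 1)) : ℕ := ((range (m + 1)).filter fun c => s c x ∉ S).card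
  have hf : ∀ x, f x ≤ 1 := by
    intro x
    refine card_le_one.2 fun c hc d hd => ?_
    simp only [mem_filter, mem_range] at hc hd
    by_contra hcd
    refine hd.2 (hS.mem_of_notMem hc.2 fun i hci hdi => hcd ?_)
    exact ZMod.natCast_injOn_le (hm i) (by omega) (by omega)
      (add_left_cancel (hci.trans hdi.symm))
  have hbij : ∀ c, Function.Bijective (s c) := fun c =>
    (Equiv.addRight (fun i => (c : ZMod (α i + 1)))).bijective
  have hsum : ∑ x, f x = ∑ _x : ∀ i, ZMod (α i + 1), 1 := by
    have h1 : ∀ c, (univ.filter fun x => s c x ∉ S).card = (univ \ S).card := by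
      intro c
      refine card_bij (fun x _ => s c x) (by simp) (fun a _ b _ h => (hbij c).1 h) ?_
      intro b hb
      obtain ⟨a, rfl⟩ := (hbij c).2 b
      exact ⟨a, by simpa using hb, rfl⟩
    have h2 : ∑ x, f x = ∑ c ∈ range (m + 1), (univ.filter fun x => s c x ∉ S).card := by
      simp only [f, card_filter]
      exact sum_comm
    rw [h2, sum_congr rfl fun c _ => h1 c, sum_const, card_range, smul_eq_mul, hcard]
    simp [Fintype.card_pi, ZMod.card]
  have hfx : f x = 1 := (sum_eq_sum_iff_of_le fun x _ => hf x).1 hsum x (mem_univ x)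
  obtain ⟨c, hc⟩ := card_pos.1 (hfx ▸ Nat.one_pos : 0 < f x)
  simp only [mem_filter, mem_range] at hc
  exact ⟨c, by omega, hc.2⟩

/-- A maximal intersecting family of exponent vectors such that every vector has one of its first
`m + 1` diagonal translates outside the family consists of the vectors that do not vanish at some
fixed coordinate of order `m + 1`. -/
lemma IsMaxIntersecting.exists_mem_iff [Fintype ι] {S : Set (∀ i, ZMod (α i + 1))}
    (hS : IsMaxIntersecting S) {m : ℕ} (hm : ∀ i, m ≤ α i) (hm2 : 2 ≤ m)
    (hshift : ∀ x : ∀ i, ZMod (α i + 1), ∃ c ≤ m, (fun i => x i + (c : ZMod (α i + 1))) ∉ S) :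
    ∃ v, α v = m ∧ ∀ x, x ∈ S ↔ x v ≠ 0 := by
  classical
  have key : ∀ {i : ι} {c d : ℕ}, c ≤ m → d ≤ m → (-(c : ZMod (α i + 1)) + d = 0) → c = d := by
    intro i c d hc hd h
    exact ZMod.natCast_injOn_le (hm i) hc hd (neg_add_eq_zero.1 h)
  have hone : ∀ i, (1 : ZMod (α i + 1)) ≠ 0 := fun i h => by
    have := ZMod.natCast_injOn_le (hm i) (c := 1) (d := 0) (by omega) (by omega) (by simpa using h)
    omega
  let ind (A : Finset ι) : ∀ i, ZMod (α i + 1) := fun i => if i ∈ A then 1 else 0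
  have hind : ∀ A i, ind A i ≠ 0 ↔ i ∈ A := fun A i => by
    by_cases h : i ∈ A <;> simp [ind, h, hone]
  have hne : S.Nonempty := by
    by_contra h
    rw [Set.not_nonempty_iff_eq_empty] at h
    have := (hS 0).2 (by simp [h])
    simp [h] at this
  have hex : ∃ A : Finset ι, ind A ∈ S := by
    obtain ⟨x, hx⟩ := hne
    exact ⟨univ.filter fun i => x i ≠ 0,
      hS.mem_of_support_subset hx fun i hi => (hind _ i).2 (by simpa using hi)⟩
  obtain ⟨A, hA, hmin⟩ := exists_min_image (univ.filter fun A => ind A ∈ S) card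
    (by obtain ⟨A, hA⟩ := hex; exact ⟨A, by simpa using hA⟩)
  simp only [mem_filter, mem_univ, true_and] at hA hmin
  obtain ⟨v, hv, -⟩ := (hS _).1 hA _ hA
  rw [hind] at hv
  have hvS : ind {v} ∈ S := by
    by_contra hvS
    have hB : ind (A.erase v) ∉ S := fun h => by
      have := hmin _ h
      have := card_erase_lt_of_mem hv
      omega
    obtain ⟨c, hc, hcS⟩ := hshift fun i => -((if i = v then 1 else if i ∈ A then 2 else 0 : ℕ) :
      ZMod (α i + 1))
    refine hcS ?_
    rcases (by omega : c = 0 ∨ c = 1 ∨ c = 2 ∨ 3 ≤ c) with rfl | rfl | rfl | h3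
    · refine hS.mem_of_support_subset hA fun i hi h => ?_
      rw [hind] at hi
      have := key (by split_ifs <;> omega) hc h
      split_ifs at this
    · refine hS.mem_of_notMem hvS fun i hi h => ?_
      have := key (by split_ifs <;> omega) hc h
      have hiv : i ≠ v := fun hiv => (hind {v} i).2 (by simp [hiv]) hi
      rw [if_neg hiv] at this
      split_ifs at this
      omega
    · refine hS.mem_of_notMem hB fun i hi h => ?_
      have := key (by split_ifs <;> omega) hc h
      have hiA : i ∉ A.erase v := fun hiA => (hind _ i).2 hiA hi
      rw [mem_erase] at hiA
      split_ifs at this <;> first | omega | tauto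
    · refine hS.mem_of_support_subset hA fun i _ h => ?_
      have := key (by split_ifs <;> omega) hc h
      split_ifs at this <;> omega
  have hiff : ∀ x, x ∈ S ↔ x v ≠ 0 := by
    intro x
    constructor
    · intro hx
      obtain ⟨i, hxi, hi⟩ := (hS x).1 hx _ hvS
      rw [hind, mem_singleton] at hi
      exact hi ▸ hxi
    · intro hx
      refine hS.mem_of_support_subset hvS fun i hi => ?_
      rw [hind, mem_singleton] at hi
      exact hi ▸ hx
  refine ⟨v, ?_, hiff⟩
  by_contra hvm
  have hlt : m + 1 ≤ α v := by have := hm v; omega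
  obtain ⟨c, hc, hcS⟩ := hshift fun _ => 1
  refine hcS ((hiff _).2 fun h => ?_)
  have := ZMod.natCast_injOn_le hlt (c := c + 1) (d := 0) (by omega) (by omega)
    (by simpa [add_comm] using h)
  omega

lemma card_filter_apply_ne_zero [Fintype ι] [DecidableEq ι] (v : ι) :
    (univ.filter fun x : ∀ i, ZMod (α i + 1) => x v ≠ 0).card =
      α v * ∏ i ∈ univ.erase v, (α i + 1) := by
  have h : (univ.filter fun x : ∀ i, ZMod (α i + 1) => x v ≠ 0) =
      Fintype.piFinset fun i => if i = v then univ.erase 0 else univ := by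
    ext x
    simp only [mem_filter, mem_univ, true_and, Fintype.mem_piFinset]
    constructor
    · intro hx i
      split_ifs with hi
      · subst hi; simpa using hx
      · simp
    · intro hx
      simpa using hx v
  rw [h, Fintype.card_piFinset, ← mul_prod_erase _ _ (mem_univ v)]
  congr 1
  · simp [ZMod.card]
  · refine prod_congr rfl fun i hi => ?_
    simp [(mem_erase.1 hi).1, ZMod.card]

end ExponentVectors

section PrimePowers

variable {ι : Type*} [Fintype ι] {p α : ι → ℕ}

/-- The product of the powers of the `p i` with exponents given by `x`. -/
def expProd (p : ι → ℕ) (x : ∀ i, ZMod (α i + 1)) : ℕ := ∏ i, p i ^ (x i).val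

lemma factorization_prod_pow (hp : ∀ i, (p i).Prime) (hinj : Function.Injective p)
    (e : ι → ℕ) (j : ι) : (∏ i, p i ^ e i).factorization (p j) = e j := by
  classical
  rw [Nat.factorization_prod_apply fun i _ => pow_ne_zero _ (hp i).ne_zero, sum_eq_single j]
  · simp [(hp j).factorization_self]
  · intro i _ hij
    simp [(hp i).factorization, hinj.ne hij]
  · simp

lemma expProd_dvd (x : ∀ i, ZMod (α i + 1)) : expProd p x ∣ ∏ i, p i ^ α i :=
  prod_dvd_prod_of_dvd _ _ fun i _ => pow_dvd_pow _ (Nat.lt_succ_iff.1 (ZMod.val_lt (x i)))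

lemma expProd_injective (hp : ∀ i, (p i).Prime) (hinj : Function.Injective p) :
    Function.Injective (expProd p : (∀ i, ZMod (α i + 1)) → ℕ) := by
  intro x y h
  funext j
  apply ZMod.val_injective
  rw [← factorization_prod_pow hp hinj (fun i => (x i).val) j,
    ← factorization_prod_pow hp hinj (fun i => (y i).val) j]
  exact congrArg (fun k => k.factorization (p j)) h

lemma exists_expProd_eq (hp : ∀ i, (p i).Prime) (hinj : Function.Injective p) {l : ℕ}
    (hl : l ∣ ∏ i, p i ^ α i) : ∃ x : ∀ i, ZMod (α i + 1), expProd p x = l := by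
  have hN : ∏ i, p i ^ α i ≠ 0 := prod_ne_zero_iff.2 fun i _ => pow_ne_zero _ (hp i).ne_zero
  have hl0 : l ≠ 0 := ne_zero_of_dvd_ne_zero hN hl
  have hle : l.factorization ≤ (∏ i, p i ^ α i).factorization :=
    (Nat.factorization_le_iff_dvd hl0 hN).2 hl
  have hval : ∀ i, ((l.factorization (p i) : ℕ) : ZMod (α i + 1)).val = l.factorization (p i) := by
    intro i
    have := hle (p i)
    rw [factorization_prod_pow hp hinj] at this
    exact ZMod.val_cast_of_lt (by omega)
  refine ⟨fun i => (l.factorization (p i) : ℕ), ?_⟩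
  simp only [expProd, hval]
  refine Nat.eq_of_factorization_eq
    (prod_ne_zero_iff.2 fun i _ => pow_ne_zero _ (hp i).ne_zero) hl0 fun q => ?_
  by_cases hq : ∃ i, p i = q
  · obtain ⟨i, rfl⟩ := hq
    exact factorization_prod_pow hp hinj _ i
  · have hzero : ∀ e : ι → ℕ, (∏ i, p i ^ e i).factorization q = 0 := by
      intro e
      rw [Nat.factorization_prod_apply fun i _ => pow_ne_zero _ (hp i).ne_zero]
      refine sum_eq_zero fun i _ => ?_
      simp [(hp i).factorization, show p i ≠ q from fun h => hq ⟨i, h⟩]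
    have := hle q
    rw [hzero] at this ⊢
    omega

lemma dvd_expProd_iff (hp : ∀ i, (p i).Prime) (hinj : Function.Injective p)
    (x : ∀ i, ZMod (α i + 1)) (v : ι) : p v ∣ expProd p x ↔ x v ≠ 0 := by
  rw [expProd, (hp v).dvd_iff_one_le_factorization
    (prod_ne_zero_iff.2 fun i _ => pow_ne_zero _ (hp i).ne_zero),
    factorization_prod_pow hp hinj, Nat.one_le_iff_ne_zero, Ne, ZMod.val_eq_zero]

lemma gcd_expProd_ne_one_iff (hp : ∀ i, (p i).Prime) (hinj : Function.Injective p)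
    (x y : ∀ i, ZMod (α i + 1)) :
    Nat.gcd (expProd p x) (expProd p y) ≠ 1 ↔ ∃ i, x i ≠ 0 ∧ y i ≠ 0 := by
  constructor
  · intro h
    obtain ⟨q, hq, hqx, hqy⟩ := Nat.Prime.not_coprime_iff_dvd.1 h
    obtain ⟨i, -, hi⟩ := (hq.prime.dvd_finsetProd_iff _).1 hqx
    obtain rfl := (Nat.prime_dvd_prime_iff_eq hq (hp i)).1 (hq.dvd_of_dvd_pow hi)
    exact ⟨i, (dvd_expProd_iff hp hinj x i).1 hqx, (dvd_expProd_iff hp hinj y i).1 hqy⟩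
  · rintro ⟨i, hx, hy⟩
    exact Nat.Prime.not_coprime_iff_dvd.2 ⟨p i, hp i, (dvd_expProd_iff hp hinj x i).2 hx,
      (dvd_expProd_iff hp hinj y i).2 hy⟩

lemma IsMaxNSet.isMaxIntersecting (hp : ∀ i, (p i).Prime) (hinj : Function.Injective p)
    {D : Finset ℕ} (hD : IsMaxNSet (∏ i, p i ^ α i) D) :
    IsMaxIntersecting {x : ∀ i, ZMod (α i + 1) | expProd p x ∈ D} := by
  intro x
  simp only [Set.mem_ofPred_eq]
  constructor
  · intro hx y hy
    exact (gcd_expProd_ne_one_iff hp hinj x y).1 (hD.1.2 _ hx _ hy)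
  · intro h
    by_contra hx
    obtain ⟨d, hd, hgcd⟩ := hD.2 _ (expProd_dvd x) hx
    obtain ⟨y, rfl⟩ := exists_expProd_eq hp hinj (hD.1.1 d hd)
    exact (gcd_expProd_ne_one_iff hp hinj x y).2 (h y hd) hgcd

lemma card_filter_expProd_mem [DecidableEq ι] (hp : ∀ i, (p i).Prime) (hinj : Function.Injective p)
    {D : Finset ℕ} (hD : ∀ d ∈ D, d ∣ ∏ i, p i ^ α i) :
    (univ.filter fun x : ∀ i, ZMod (α i + 1) => expProd p x ∈ D).card = D.card := by
  refine card_bij (fun x _ => expProd p x) (by simp)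
    (fun x _ y _ h => expProd_injective hp hinj h) fun d hd => ?_
  obtain ⟨x, rfl⟩ := exists_expProd_eq hp hinj (hD d hd)
  exact ⟨x, by simpa using hd, rfl⟩

lemma card_filter_prime_dvd_divisors [DecidableEq ι] (hp : ∀ i, (p i).Prime)
    (hinj : Function.Injective p) (v : ι) :
    ((∏ i, p i ^ α i).divisors.filter fun d => p v ∣ d).card =
      α v * ∏ i ∈ univ.erase v, (α i + 1) := by
  have hN : ∏ i, p i ^ α i ≠ 0 := prod_ne_zero_iff.2 fun i _ => pow_ne_zero _ (hp i).ne_zero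
  rw [← card_filter_apply_ne_zero v, ← card_filter_expProd_mem (α := α) hp hinj
    fun d hd => Nat.dvd_of_mem_divisors (mem_filter.1 hd).1]
  congr 1
  ext x
  simp only [mem_filter, mem_univ, true_and, Nat.mem_divisors, dvd_expProd_iff hp hinj]
  exact ⟨fun h => h.2, fun h => ⟨⟨expProd_dvd x, hN⟩, h⟩⟩

lemma IsMaxNSet.exists_eq_filter_of_card [DecidableEq ι] (hp : ∀ i, (p i).Prime)
    (hinj : Function.Injective p) {D : Finset ℕ} (hD : IsMaxNSet (∏ i, p i ^ α i) D) {w : ι}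
    (hw : ∀ i, α w ≤ α i) (hw2 : 2 ≤ α w)
    (hcard : D.card = α w * ∏ i ∈ univ.erase w, (α i + 1)) :
    ∃ v, α v = α w ∧ D = (∏ i, p i ^ α i).divisors.filter fun d => p v ∣ d := by
  have hN : ∏ i, p i ^ α i ≠ 0 := prod_ne_zero_iff.2 fun i _ => pow_ne_zero _ (hp i).ne_zero
  let S := univ.filter fun x : ∀ i, ZMod (α i + 1) => expProd p x ∈ D
  have hS : IsMaxIntersecting (S : Set (∀ i, ZMod (α i + 1))) := by
    simpa [S] using hD.isMaxIntersecting hp hinj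
  have hT : ∏ i, (α i + 1) = (α w + 1) * ∏ i ∈ univ.erase w, (α i + 1) :=
    (mul_prod_erase _ _ (mem_univ w)).symm
  have hScard : (α w + 1) * (univ \ S).card = ∏ i, (α i + 1) := by
    rw [card_sdiff_of_subset (subset_univ S), card_filter_expProd_mem hp hinj hD.1.1, hcard,
      card_univ, Fintype.card_pi]
    simp only [ZMod.card]
    rw [hT, ← Nat.sub_mul, Nat.add_sub_cancel_left, one_mul]
  obtain ⟨v, hv, hiff⟩ := hS.exists_mem_iff hw hw2 (by simpa using hS.exists_add_notMem hw hScard)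
  refine ⟨v, hv, ?_⟩
  ext d
  simp only [mem_filter, Nat.mem_divisors]
  have aux : ∀ x : ∀ i, ZMod (α i + 1), expProd p x ∈ D ↔ p v ∣ expProd p x := fun x => by
    rw [dvd_expProd_iff hp hinj, ← hiff x]
    simp [S]
  constructor
  · intro hd
    obtain ⟨x, rfl⟩ := exists_expProd_eq hp hinj (hD.1.1 d hd)
    exact ⟨⟨expProd_dvd x, hN⟩, (aux x).1 hd⟩
  · rintro ⟨⟨hd, -⟩, hvd⟩
    obtain ⟨x, rfl⟩ := exists_expProd_eq hp hinj hd
    exact (aux x).2 hvd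

end PrimePowers

section Divisors

variable {N q : ℕ} {D : Finset ℕ}

lemma IsMaxNSet.eq_filter_of_dSet_eq (hN : N ≠ 0) (hq : q.Prime) (hD : IsMaxNSet N D)
    (hd : dSet D = {q}) : D = N.divisors.filter fun d => q ∣ d := by
  have hall : ∀ d ∈ D, q ∣ d := by
    intro d
    induction d using Nat.strong_induction_on with
    | _ d ih =>
      intro hdD
      by_cases hmin : d ∈ dSet D
      · rw [hd, mem_singleton] at hmin
        exact hmin ▸ dvd_rfl
      · simp only [dSet, mem_filter, not_and, not_forall] at hmin
        obtain ⟨e, he, hed, hne⟩ := hmin hdD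
        have hd0 : d ≠ 0 := ne_zero_of_dvd_ne_zero hN (hD.1.1 d hdD)
        exact (ih e (lt_of_le_of_ne (Nat.le_of_dvd (Nat.pos_of_ne_zero hd0) hed) hne) he).trans hed
  ext d
  simp only [mem_filter, Nat.mem_divisors]
  refine ⟨fun h => ⟨⟨hD.1.1 d h, hN⟩, hall d h⟩, fun ⟨⟨h, _⟩, hqd⟩ => ?_⟩
  by_contra hdD
  obtain ⟨e, he, hgcd⟩ := hD.2 d h hdD
  exact Nat.Prime.not_coprime_iff_dvd.2 ⟨q, hq, hqd, hall e he⟩ hgcd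

lemma isMaxNSet_filter_prime_dvd (hN : N ≠ 0) (hq : q.Prime) (hqN : q ∣ N) :
    IsMaxNSet N (N.divisors.filter fun d => q ∣ d) := by
  simp only [IsMaxNSet, IsNSet, mem_filter, Nat.mem_divisors]
  refine ⟨⟨fun d hd => hd.1.1, fun d hd e he => ?_⟩, fun l hl hlD => ?_⟩
  · exact Nat.Prime.not_coprime_iff_dvd.2 ⟨q, hq, hd.2, he.2⟩
  · exact ⟨q, ⟨⟨hqN, hN⟩, dvd_rfl⟩,
      ((hq.coprime_iff_not_dvd).2 fun h => hlD ⟨⟨hl, hN⟩, h⟩).symm⟩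

lemma dSet_filter_prime_dvd (hN : N ≠ 0) (hqN : q ∣ N) :
    dSet (N.divisors.filter fun d => q ∣ d) = {q} := by
  ext d
  simp only [dSet, mem_filter, Nat.mem_divisors, mem_singleton]
  constructor
  · rintro ⟨⟨-, hqd⟩, h⟩
    exact (h q ⟨⟨hqN, hN⟩, dvd_rfl⟩ hqd).symm
  · rintro rfl
    exact ⟨⟨⟨hqN, hN⟩, dvd_rfl⟩, fun e he hed => Nat.dvd_antisymm hed he.2⟩

end Divisors

/-- **Theorem 1.** With `α₁ ≥ ⋯ ≥ α_u > α_{u+1} = ⋯ = α_n ≥ 2` (0-indexed: indices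
`< u` are the strictly larger exponents, indices `≥ u` form the constant tail) and
`N = p₁^{α₁} ⋯ p_n^{α_n}`, for a set `D` of positive divisors of `N` the following are
equivalent: (a) `D` is a maximal `N`-set of minimum size
`α_n ∏_{i=1}^{n-1} (α_i + 1)`; (b) `D` is a maximal `N`-set with `d(D) = {p_v}` for
some `u+1 ≤ v ≤ n`; (c) `D = {d : d ∣ N, p_v ∣ d}` for some `u+1 ≤ v ≤ n`. -/
theorem stmt_0 (n u : ℕ) (hu : u < n) (p α : Fin n → ℕ)
    (hp : ∀ i, (p i).Prime) (hinj : Function.Injective p)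
    (hanti : ∀ i j : Fin n, i ≤ j → α j ≤ α i)
    (hconst : ∀ i : Fin n, u ≤ (i : ℕ) → α i = α ⟨u, hu⟩)
    (hstrict : ∀ i : Fin n, (i : ℕ) < u → α ⟨u, hu⟩ < α i)
    (h2 : 2 ≤ α ⟨u, hu⟩)
    (N : ℕ) (hN : N = ∏ i, p i ^ α i)
    (D : Finset ℕ) (hDdvd : ∀ d ∈ D, d ∣ N) :
    ((IsMaxNSet N D ∧
        D.card = α ⟨n - 1, by omega⟩ *
          ∏ i ∈ Finset.univ.erase ⟨n - 1, by omega⟩, (α i + 1)) ↔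
      (IsMaxNSet N D ∧ ∃ v : Fin n, u ≤ (v : ℕ) ∧ dSet D = {p v})) ∧
    ((IsMaxNSet N D ∧ ∃ v : Fin n, u ≤ (v : ℕ) ∧ dSet D = {p v}) ↔
      (∃ v : Fin n, u ≤ (v : ℕ) ∧ D = N.divisors.filter fun d => p v ∣ d)) := by
  have hN0 : N ≠ 0 := hN ▸ prod_ne_zero_iff.2 fun i _ => pow_ne_zero _ (hp i).ne_zero
  have hmin : ∀ i, α ⟨u, hu⟩ ≤ α i := fun i => by
    rcases lt_or_ge (i : ℕ) u with h | h
    · exact (hstrict i h).le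
    · exact (hconst i h).ge
  have hlast : α ⟨n - 1, by omega⟩ = α ⟨u, hu⟩ := hconst _ (by simp; omega)
  have hpN : ∀ v, p v ∣ N := fun v => by
    rw [hN]
    exact (dvd_pow_self _ (by have := hmin v; omega)).trans (dvd_prod_of_mem _ (mem_univ v))
  have hbc : (IsMaxNSet N D ∧ ∃ v : Fin n, u ≤ (v : ℕ) ∧ dSet D = {p v}) ↔
      (∃ v : Fin n, u ≤ (v : ℕ) ∧ D = N.divisors.filter fun d => p v ∣ d) := by
    constructor
    · rintro ⟨hD, v, hv, hd⟩
      exact ⟨v, hv, hD.eq_filter_of_dSet_eq hN0 (hp v) hd⟩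
    · rintro ⟨v, hv, rfl⟩
      exact ⟨isMaxNSet_filter_prime_dvd hN0 (hp v) (hpN v), v, hv,
        dSet_filter_prime_dvd hN0 (hpN v)⟩
  refine ⟨?_, hbc⟩
  rw [hbc]
  constructor
  · rintro ⟨hD, hcard⟩
    rw [hN] at hD
    obtain ⟨v, hv, hDv⟩ := hD.exists_eq_filter_of_card hp hinj (fun i => hlast ▸ hmin i)
      (hlast ▸ h2) hcard
    refine ⟨v, ?_, hN ▸ hDv⟩
    by_contra hvu
    have := hstrict v (by omega)
    omega
  · rintro ⟨v, hv, rfl⟩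
    refine ⟨isMaxNSet_filter_prime_dvd hN0 (hp v) (hpN v), ?_⟩
    rw [hN, card_filter_prime_dvd_divisors hp hinj v, hlast, hconst v hv]
    congr 1
    refine Nat.eq_of_mul_eq_mul_left (Nat.succ_pos (α ⟨u, hu⟩)) ?_
    have hv' := mul_prod_erase univ (fun i => α i + 1) (mem_univ v)
    have hl' := mul_prod_erase univ (fun i => α i + 1) (mem_univ (⟨n - 1, by omega⟩ : Fin n))
    rw [hconst v hv] at hv'
    rw [hlast] at hl'
    exact hv'.trans hl'.symm
end

section
/- Let p_1, ..., p_n be distinct primes, let α_1 ≥ α_2 ≥ ... ≥ α_u > α_{u+1} = ... = α_n ≥ 2 (with u = 0 if all α_i are equal), and let N = p_1^{α_1}···p_n^{α_n}. If D is a maximal N-set with |D| = α_n · ∏_{i=1}^{n-1} (α_i + 1), then there exists v with u+1 ≤ v ≤ n such that D = { d : d ∣ N, p_v ∣ d }. -/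
open Finset

/-- A set of vectors in `∏ i, ZMod (m i)`, any two of which agree in some coordinate, and whose
density is `1 / k` with `k ≤ m i` for all `i`, meets every window of `k` diagonal translates. -/
theorem exists_add_natCast_mem_of_card_mul_eq {ι : Type*} [Fintype ι] [DecidableEq ι]
    (m : ι → ℕ) [∀ i, NeZero (m i)] (k : ℕ) (hk : ∀ i, k ≤ m i) (Z : Finset (∀ i, ZMod (m i)))
    (hZ : ∀ x ∈ Z, ∀ y ∈ Z, ∃ i, x i = y i) (hcard : #Z * k = ∏ i, m i)
    (x : ∀ i, ZMod (m i)) :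
    ∃ t < k, x + (t : ∀ i, ZMod (m i)) ∈ Z := by
  have hle : ∀ x ∈ (univ : Finset (∀ i, ZMod (m i))),
      #{t ∈ range k | x + ((t : ℕ) : ∀ i, ZMod (m i)) ∈ Z} ≤ 1 := by
    intro x _
    rw [card_le_one]
    intro s hs t ht
    rw [mem_filter, mem_range] at hs ht
    obtain ⟨i, hi⟩ := hZ _ hs.2 _ ht.2
    simp only [Pi.add_apply, Pi.natCast_apply, add_right_inj] at hi
    rw [ZMod.natCast_eq_natCast_iff] at hi
    exact hi.eq_of_lt_of_lt (hs.1.trans_le (hk i)) (ht.1.trans_le (hk i))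
  have hsum : ∑ x : (∀ i, ZMod (m i)), #{t ∈ range k | x + ((t : ℕ) : ∀ i, ZMod (m i)) ∈ Z}
      = ∑ x : (∀ i, ZMod (m i)), 1 := by
    simp only [card_filter]
    rw [sum_comm]
    have hshift : ∀ t ∈ range k,
        ∑ x : (∀ i, ZMod (m i)), (if x + (t : ∀ i, ZMod (m i)) ∈ Z then 1 else 0) = #Z := by
      intro t _
      have h := Equiv.sum_comp (Equiv.addRight (t : ∀ i, ZMod (m i)))
        (fun y => if y ∈ Z then 1 else 0)
      rw [sum_ite_mem, univ_inter, sum_const, smul_eq_mul, mul_one] at h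
      exact h
    rw [sum_congr rfl hshift]
    simp [Fintype.card_pi, ZMod.card, ← hcard, mul_comm]
  have hone := (sum_eq_sum_iff_of_le hle).1 hsum x (mem_univ x)
  obtain ⟨t, ht⟩ := card_pos.1 (hone ▸ Nat.one_pos)
  rw [mem_filter, mem_range] at ht
  exact ⟨t, ht⟩

section PrimePowers

variable {ι : Type*} [Fintype ι] {p : ι → ℕ}

theorem factorization_prod_prime_pow (hp : ∀ i, (p i).Prime) (hinj : Function.Injective p)
    (a : ι → ℕ) (j : ι) : (∏ i, p i ^ a i).factorization (p j) = a j := by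
  classical
  rw [Nat.factorization_prod fun i _ => pow_ne_zero _ (hp i).ne_zero, Finsupp.finsetSum_apply,
    sum_eq_single j]
  · simp [(hp j).factorization]
  · intro i _ hij
    simp [(hp i).factorization, hinj.ne hij]
  · simp

theorem dvd_prod_prime_pow_iff (hp : ∀ i, (p i).Prime) (hinj : Function.Injective p)
    (a : ι → ℕ) (j : ι) : p j ∣ ∏ i, p i ^ a i ↔ a j ≠ 0 := by
  rw [(hp j).dvd_iff_one_le_factorization
      (prod_ne_zero_iff.2 fun i _ => pow_ne_zero _ (hp i).ne_zero),
    factorization_prod_prime_pow hp hinj, Nat.one_le_iff_ne_zero]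

theorem exists_eq_of_prime_dvd_prod_prime_pow (hp : ∀ i, (p i).Prime) (a : ι → ℕ) {q : ℕ}
    (hq : q.Prime) (h : q ∣ ∏ i, p i ^ a i) : ∃ i, q = p i := by
  obtain ⟨i, _, hi⟩ := hq.prime.exists_mem_finset_dvd h
  exact ⟨i, (Nat.prime_dvd_prime_iff_eq hq (hp i)).1 (hq.dvd_of_dvd_pow hi)⟩

theorem eq_prod_prime_pow_factorization (hp : ∀ i, (p i).Prime) (hinj : Function.Injective p)
    {a : ι → ℕ} {d : ℕ} (hd : d ∣ ∏ i, p i ^ a i) : d = ∏ i, p i ^ d.factorization (p i) := by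
  have hne : ∀ b : ι → ℕ, ∏ i, p i ^ b i ≠ 0 :=
    fun b => prod_ne_zero_iff.2 fun i _ => pow_ne_zero _ (hp i).ne_zero
  refine Nat.eq_of_factorization_eq (ne_zero_of_dvd_ne_zero (hne a) hd) (hne _) fun q => ?_
  by_cases hq : ∃ i, q = p i
  · obtain ⟨i, rfl⟩ := hq
    rw [factorization_prod_prime_pow hp hinj]
  · by_cases hqp : q.Prime
    · rw [Nat.factorization_eq_zero_of_not_dvd, Nat.factorization_eq_zero_of_not_dvd]
      · exact fun h => hq (exists_eq_of_prime_dvd_prod_prime_pow hp _ hqp h)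
      · exact fun h => hq (exists_eq_of_prime_dvd_prod_prime_pow hp _ hqp (h.trans hd))
    · rw [Nat.factorization_eq_zero_of_not_prime _ hqp, Nat.factorization_eq_zero_of_not_prime _ hqp]

/-- The divisors of `∏ i, p i ^ a i` lying in `D` correspond to exponent vectors. -/
theorem card_filter_prod_prime_pow_mem [DecidableEq ι] (hp : ∀ i, (p i).Prime)
    (hinj : Function.Injective p) (a : ι → ℕ) {D : Finset ℕ} (hD : ∀ d ∈ D, d ∣ ∏ i, p i ^ a i) :
    #{x : ∀ i, ZMod (a i + 1) | ∏ i, p i ^ (x i).val ∈ D} = #D := by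
  refine card_bij (fun x _ => ∏ i, p i ^ (x i).val) (fun x hx => (mem_filter.1 hx).2) ?_ ?_
  · intro x _ y _ hxy
    funext i
    have h := congrArg (fun d => d.factorization (p i)) hxy
    simp only [factorization_prod_prime_pow hp hinj] at h
    exact ZMod.val_injective _ h
  · intro d hd
    have hle : ∀ i, d.factorization (p i) ≤ a i := by
      intro i
      rw [← factorization_prod_prime_pow hp hinj a i]
      exact (Nat.factorization_le_iff_dvd
        (ne_zero_of_dvd_ne_zero (prod_ne_zero_iff.2 fun i _ => pow_ne_zero _ (hp i).ne_zero)
          (hD d hd))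
        (prod_ne_zero_iff.2 fun i _ => pow_ne_zero _ (hp i).ne_zero)).2 (hD d hd) (p i)
    have heq : ∏ i, p i ^ ((d.factorization (p i) : ℕ) : ZMod (a i + 1)).val = d := by
      conv_rhs => rw [eq_prod_prime_pow_factorization hp hinj (hD d hd)]
      refine prod_congr rfl fun i _ => ?_
      rw [ZMod.val_natCast_of_lt (Nat.lt_succ_of_le (hle i))]
    exact ⟨fun i => (d.factorization (p i) : ℕ), mem_filter.2 ⟨mem_univ _, heq.symm ▸ hd⟩, heq⟩

end PrimePowers

/-- With `α₁ ≥ ⋯ ≥ α_u > α_{u+1} = ⋯ = α_n ≥ 2` (0-indexed) and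
`N = p₁^{α₁} ⋯ p_n^{α_n}`: if `D` is a maximal `N`-set with
`|D| = α_n ∏_{i=1}^{n-1} (α_i + 1)`, then `D = {d : d ∣ N, p_v ∣ d}` for some
`u+1 ≤ v ≤ n`. -/
theorem stmt_1 (n u : ℕ) (hu : u < n) (p α : Fin n → ℕ)
    (hp : ∀ i, (p i).Prime) (hinj : Function.Injective p)
    (hanti : ∀ i j : Fin n, i ≤ j → α j ≤ α i)
    (hconst : ∀ i : Fin n, u ≤ (i : ℕ) → α i = α ⟨u, hu⟩)
    (hstrict : ∀ i : Fin n, (i : ℕ) < u → α ⟨u, hu⟩ < α i)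
    (h2 : 2 ≤ α ⟨u, hu⟩)
    (N : ℕ) (hN : N = ∏ i, p i ^ α i)
    (D : Finset ℕ) (hD : IsMaxNSet N D)
    (hcard : D.card = α ⟨n - 1, by omega⟩ *
      ∏ i ∈ Finset.univ.erase ⟨n - 1, by omega⟩, (α i + 1)) :
    ∃ v : Fin n, u ≤ (v : ℕ) ∧ D = N.divisors.filter fun d => p v ∣ d := by
  subst hN
  obtain ⟨⟨hdvd, hgcd⟩, hmax⟩ := hD
  set N := ∏ i, p i ^ α i
  set l : Fin n := ⟨n - 1, by omega⟩ with hl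
  have hαl : α l = α ⟨u, hu⟩ := hconst l (by simp only [hl]; omega)
  have hmin : ∀ i, α l ≤ α i := fun i => hanti i l (by rw [Fin.le_def]; simp only [hl]; omega)
  -- `P T`: some member of `D` is composed only of primes indexed by `T`
  let P : Finset (Fin n) → Prop := fun T => ∃ d ∈ D, ∀ i, p i ∣ d → i ∈ T
  have hPmono : ∀ {S T}, S ⊆ T → P S → P T :=
    fun hST ⟨d, hd, h⟩ => ⟨d, hd, fun i hi => hST (h i hi)⟩
  have hPinter : ∀ {S T}, P S → P T → ∃ i ∈ S, i ∈ T := by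
    rintro S T ⟨d, hd, hS⟩ ⟨e, he, hT⟩
    obtain ⟨q, hq, hqd⟩ := Nat.exists_prime_and_dvd (hgcd d hd e he)
    have hqd' := hqd.trans (Nat.gcd_dvd_left d e)
    obtain ⟨i, rfl⟩ := exists_eq_of_prime_dvd_prod_prime_pow hp α hq (hqd'.trans (hdvd d hd))
    exact ⟨i, hS i hqd', hT i (hqd.trans (Nat.gcd_dvd_right d e))⟩
  have hPnot : ∀ e, e ∣ N → e ∉ D → P {i | ¬ p i ∣ e} := by
    intro e he heD
    obtain ⟨d, hd, hed⟩ := hmax e he heD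
    refine ⟨d, hd, fun i hi => ?_⟩
    simp only [mem_filter, mem_univ, true_and]
    intro hie
    exact (hp i).one_lt.ne' (Nat.dvd_one.1 (hed ▸ Nat.dvd_gcd hie hi))
  let f : (∀ i, ZMod (α i + 1)) → ℕ := fun x => ∏ i, p i ^ (x i).val
  have hfdvd : ∀ x, f x ∣ N := fun x =>
    prod_dvd_prod_of_dvd _ _ fun i _ => pow_dvd_pow _ (Nat.le_of_lt_succ (ZMod.val_lt (x i)))
  have hpf : ∀ x i, p i ∣ f x ↔ x i ≠ 0 := fun x i => by
    rw [dvd_prod_prime_pow_iff hp hinj, Ne, ZMod.val_eq_zero]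
  have hPzero : ∀ x, f x ∉ D → P {i | x i = 0} := fun x hx => by
    simpa only [hpf, not_not] using hPnot _ (hfdvd x) hx
  have hwindow : ∀ x : (∀ i, ZMod (α i + 1)),
      ∃ t < α l + 1, f (x + (t : ∀ i, ZMod (α i + 1))) ∉ D := by
    intro x
    have hwin := exists_add_natCast_mem_of_card_mul_eq (fun i => α i + 1) (α l + 1)
      (fun i => Nat.succ_le_succ (hmin i)) {x | f x ∉ D} ?_ ?_ x
    · simpa using hwin
    · intro x hx y hy
      obtain ⟨i, hi, hi'⟩ := hPinter (hPzero x (by simpa using hx)) (hPzero y (by simpa using hy))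
      simp only [mem_filter, mem_univ, true_and] at hi hi'
      exact ⟨i, hi.trans hi'.symm⟩
    · have h1 := card_filter_add_card_filter_not (s := univ) (fun x => f x ∈ D)
      rw [card_filter_prod_prime_pow_mem hp hinj α hdvd, hcard, card_univ, Fintype.card_pi] at h1
      simp only [ZMod.card] at h1
      rw [← mul_prod_erase univ (fun i => α i + 1) (mem_univ l)] at h1 ⊢
      rw [add_mul, one_mul, add_right_inj] at h1
      rw [h1, mul_comm]
  have hPuniv : ∃ S, P S := by
    obtain ⟨t, -, ht⟩ := hwindow 0
    exact ⟨_, hPzero _ ht⟩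
  obtain ⟨S, hS, hSmin⟩ : ∃ S, P S ∧ ∀ T, T ⊂ S → ¬ P T := by
    obtain ⟨S, hS, hSmin⟩ := WellFounded.has_min (wellFounded_lt (α := Finset (Fin n)))
      {S | P S} hPuniv
    exact ⟨S, hS, fun T hT hPT => hSmin T hPT hT⟩
  obtain ⟨v, hv, -⟩ := hPinter hS hS
  have hSv : S = {v} := by
    by_contra hne
    have hnv : ¬ P {v} := hSmin _ (ssubset_of_subset_of_ne (singleton_subset_iff.2 hv) (Ne.symm hne))
    have hnS : ¬ P (S.erase v) := hSmin _ (erase_ssubset hv)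
    have hnc : ¬ P Sᶜ := fun h => by
      obtain ⟨i, hi, hi'⟩ := hPinter hS h
      exact mem_compl.1 hi' hi
    -- the zero sets along this window are `{v}`, `S.erase v`, `Sᶜ` and then empty
    let c : Fin n → ℕ := fun i => if i = v then 0 else if i ∈ S then 1 else 2
    have hc : ∀ i, c i ≤ 2 := fun i => by dsimp only [c]; split_ifs <;> omega
    obtain ⟨t, ht, htD⟩ := hwindow fun i => -(c i : ZMod (α i + 1))
    have hPt := hPzero _ htD
    have hzero : ∀ i, -(c i : ZMod (α i + 1)) + (t : ZMod (α i + 1)) = 0 → c i = t := by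
      intro i hi
      rw [neg_add_eq_zero, ZMod.natCast_eq_natCast_iff] at hi
      have := hmin i
      have := hc i
      exact hi.eq_of_lt_of_lt (by omega) (by omega)
    have hPc : P {i | c i = t} := by
      refine hPmono (fun i hi => ?_) hPt
      simp only [mem_filter, mem_univ, true_and, Pi.add_apply, Pi.natCast_apply] at hi ⊢
      exact hzero i hi
    rcases (by omega : t = 0 ∨ t = 1 ∨ 2 ≤ t) with h | h | h
    · refine hnv (hPmono (fun i hi => ?_) hPc)
      simp only [mem_filter, mem_univ, true_and, c] at hi
      rw [mem_singleton]
      split_ifs at hi <;> first | assumption | omega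
    · refine hnS (hPmono (fun i hi => ?_) hPc)
      simp only [mem_filter, mem_univ, true_and, c] at hi
      rw [mem_erase]
      split_ifs at hi <;> first | exact ⟨by assumption, by assumption⟩ | omega
    · refine hnc (hPmono (fun i hi => ?_) hPc)
      simp only [mem_filter, mem_univ, true_and, c] at hi
      rw [mem_compl]
      split_ifs at hi <;> first | assumption | omega
  subst hSv
  have hmem : ∀ d, d ∣ N → (d ∈ D ↔ p v ∣ d) := by
    intro d hd
    constructor
    · intro hdD
      obtain ⟨i, hi, hi'⟩ := hPinter hS (T := {i | p i ∣ d}) ⟨d, hdD, fun i hi => by simpa using hi⟩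
      rw [mem_singleton] at hi
      simpa [hi] using hi'
    · intro hvd
      by_contra hdD
      obtain ⟨i, hi, hi'⟩ := hPinter hS (hPnot d hd hdD)
      rw [mem_singleton] at hi
      simp [hi, hvd] at hi'
  refine ⟨v, ?_, ?_⟩
  · by_contra hlt
    have hαv := hstrict v (by omega)
    obtain ⟨t, ht, htD⟩ := hwindow 1
    rw [hmem _ (hfdvd _), hpf, not_not] at htD
    simp only [Pi.add_apply, Pi.one_apply, Pi.natCast_apply] at htD
    have hdiv : ((1 + t : ℕ) : ZMod (α v + 1)) = 0 := by exact_mod_cast htD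
    rw [ZMod.natCast_eq_zero_iff] at hdiv
    have := Nat.le_of_dvd (by omega) hdiv
    omega
  · ext d
    rw [mem_filter, Nat.mem_divisors]
    have hN0 : N ≠ 0 := prod_ne_zero_iff.2 fun i _ => pow_ne_zero _ (hp i).ne_zero
    exact ⟨fun hd => ⟨⟨hdvd d hd, hN0⟩, (hmem d (hdvd d hd)).1 hd⟩,
      fun hd => (hmem d hd.1.1).2 hd.2⟩
end

section
/- Let p_1, ..., p_n be distinct primes, let α_1 ≥ α_2 ≥ ... ≥ α_u > α_{u+1} = ... = α_n = 1 (with u = 0 if all α_i equal 1), and let N = p_1^{α_1}···p_n^{α_n}. If D is a maximal N-set with |D| = α_n · ∏_{i=1}^{n-1} (α_i + 1), then every divisible minimal element of D divides p_{u+1}···p_n, i.e. d(D) ⊆ { d : d ∣ p_{u+1}···p_n }. -/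
open Finset

/-- The number of divisors of a product of powers of distinct primes. -/
theorem card_divisors_prod_primes_pow {ι : Type*} (s : Finset ι) (p α : ι → ℕ)
    (hp : ∀ i, (p i).Prime) (hinj : Function.Injective p) :
    (∏ i ∈ s, p i ^ α i).divisors.card = ∏ i ∈ s, (α i + 1) := by
  classical
  induction s using Finset.induction_on with
  | empty => simp
  | insert a s ha ih =>
    rw [Finset.prod_insert ha, Finset.prod_insert ha, Nat.Coprime.card_divisors_mul, ih,
      Nat.divisors_prime_pow (hp a)]
    · simp
    · refine Nat.Coprime.prod_right fun i hi => Nat.Coprime.pow _ _ ?_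
      exact (Nat.coprime_primes (hp a) (hp i)).2 fun h => ha (hinj h ▸ hi)

/-- A squarefree number divides every number divisible by all its prime factors. -/
theorem Squarefree.dvd_of_forall_prime_dvd {d m : ℕ} (hd : Squarefree d)
    (h : ∀ q, q.Prime → q ∣ d → q ∣ m) : d ∣ m := by
  rw [← Nat.prod_primeFactors_of_squarefree hd]
  refine Finset.prod_primes_dvd m (fun q hq => (Nat.prime_of_mem_primeFactors hq).prime) ?_
  exact fun q hq => h q (Nat.prime_of_mem_primeFactors hq) (Nat.dvd_of_mem_primeFactors hq)

/-- Membership in a maximal `N`-set passes to divisors of `N` with more prime factors. -/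
theorem IsMaxNSet.mem_of_forall_prime_dvd {N : ℕ} {D : Finset ℕ} (hD : IsMaxNSet N D) {d l : ℕ}
    (hd : d ∈ D) (hl : l ∣ N) (h : ∀ q, q.Prime → q ∣ d → q ∣ l) : l ∈ D := by
  by_contra hlD
  obtain ⟨e, he, hle⟩ := hD.2 l hl hlD
  obtain ⟨q, hq, hqde⟩ := Nat.exists_prime_and_dvd (hD.1.2 d hd e he)
  have hql : q ∣ Nat.gcd l e :=
    Nat.dvd_gcd (h q hq (hqde.trans (Nat.gcd_dvd_left _ _))) (hqde.trans (Nat.gcd_dvd_right _ _))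
  exact hq.one_lt.ne' (Nat.dvd_one.1 (hle ▸ hql))

/-- A maximal `N`-set contains the codivisor of every divisor it omits. -/
theorem IsMaxNSet.div_mem {N : ℕ} {D : Finset ℕ} (hD : IsMaxNSet N D) {l : ℕ}
    (hl : l ∣ N) (hlD : l ∉ D) : N / l ∈ D := by
  obtain ⟨e, he, hle⟩ := hD.2 l hl hlD
  refine hD.mem_of_forall_prime_dvd he (Nat.div_dvd_of_dvd hl) fun q _ hqe => hqe.trans ?_
  refine (Nat.Coprime.symm hle).dvd_of_dvd_mul_left ?_
  rw [Nat.mul_div_cancel' hl]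
  exact hD.1.1 e he

/-- A maximal `N`-set with half of the divisors of `N` contains no complementary pair. -/
theorem IsMaxNSet.div_notMem {N : ℕ} (hN : N ≠ 0) {D : Finset ℕ} (hD : IsMaxNSet N D)
    (hcard : N.divisors.card = 2 * D.card) {d : ℕ} (hd : d ∈ D) : N / d ∉ D := by
  have hsub : D ⊆ N.divisors := fun x hx => Nat.mem_divisors.2 ⟨hD.1.1 x hx, hN⟩
  have himage : (N.divisors \ D).image (fun l => N / l) = D := by
    refine Finset.eq_of_subset_of_card_le ?_ ?_
    · refine Finset.image_subset_iff.2 fun l hl => ?_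
      rw [Finset.mem_sdiff] at hl
      exact hD.div_mem (Nat.dvd_of_mem_divisors hl.1) hl.2
    · rw [Finset.card_image_of_injOn, Finset.card_sdiff_of_subset hsub]
      · omega
      · intro x hx y hy hxy
        simp only [Finset.coe_sdiff, Set.mem_sdiff, Finset.mem_coe, Nat.mem_divisors] at hx hy
        have := congrArg (fun z => N / z) hxy
        simpa only [Nat.div_div_self hx.1.1 hN, Nat.div_div_self hy.1.1 hN] using this
  rw [← himage] at hd
  obtain ⟨l, hl, rfl⟩ := Finset.mem_image.1 hd
  rw [Finset.mem_sdiff] at hl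
  rw [Nat.div_div_self (Nat.dvd_of_mem_divisors hl.1) hN]
  exact hl.2

/-- In a maximal `N`-set with half of the divisors of `N`, the prime factors of a divisible minimal
element divide `N` exactly once. -/
theorem IsMaxNSet.not_sq_dvd_of_mem_dSet {N : ℕ} (hN : N ≠ 0) {D : Finset ℕ} (hD : IsMaxNSet N D)
    (hcard : N.divisors.card = 2 * D.card) {d q : ℕ} (hd : d ∈ dSet D) (hq : q.Prime)
    (hqd : q ∣ d) : ¬ q * q ∣ N := by
  intro hqN
  obtain ⟨hdD, hmin⟩ := Finset.mem_filter.1 hd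
  refine hD.div_notMem hN hcard hdD ?_
  obtain ⟨k, hk⟩ := hD.1.1 d hdD
  obtain ⟨m, rfl⟩ := hqd
  have hd0 : q * m ≠ 0 := fun h => hN (by rw [hk, h, Nat.zero_mul])
  have hmN : m ∣ N := (Dvd.intro_left q rfl).trans (hD.1.1 _ hdD)
  have hmD : m ∉ D := fun hm => by
    have hmq := hmin m hm (Dvd.intro_left q rfl)
    have := hq.two_le
    have : 0 < m := Nat.pos_of_ne_zero (right_ne_zero_of_mul hd0)
    nlinarith
  have hqm : ¬ q ∣ m := fun hqm => hmD <| hD.mem_of_forall_prime_dvd hdD hmN fun r hr hrd =>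
    (hr.dvd_mul.1 hrd).elim (fun h => h.trans hqm) id
  obtain ⟨e, he, hme⟩ := hD.2 m hmN hmD
  refine hD.mem_of_forall_prime_dvd he (Nat.div_dvd_of_dvd (hD.1.1 _ hdD)) fun r hr hre => ?_
  rw [hk, Nat.mul_div_cancel_left _ (Nat.pos_of_ne_zero hd0)]
  have hrm : ¬ r ∣ m := fun h => hr.one_lt.ne' (Nat.dvd_one.1 (hme ▸ Nat.dvd_gcd h hre))
  by_cases hrq : r = q
  · subst hrq
    rw [hk, Nat.mul_assoc] at hqN
    exact (hr.dvd_mul.1 (Nat.dvd_of_mul_dvd_mul_left hr.pos hqN)).resolve_left hrm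
  · have hrN : r ∣ q * m * k := hk ▸ hre.trans (hD.1.1 e he)
    refine (hr.dvd_mul.1 hrN).resolve_left fun h => ?_
    exact (hr.dvd_mul.1 h).elim (fun h => hrq ((Nat.prime_dvd_prime_iff_eq hr hq).1 h)) hrm

/-- With `α₁ ≥ ⋯ ≥ α_u > α_{u+1} = ⋯ = α_n = 1` (0-indexed) and
`N = p₁^{α₁} ⋯ p_n^{α_n}`: if `D` is a maximal `N`-set with
`|D| = α_n ∏_{i=1}^{n-1} (α_i + 1)`, then every divisible minimal element of `D`
divides `P = p_{u+1} ⋯ p_n`. -/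
theorem stmt_3 (n u : ℕ) (hu : u < n) (p α : Fin n → ℕ)
    (hp : ∀ i, (p i).Prime) (hinj : Function.Injective p)
    (hanti : ∀ i j : Fin n, i ≤ j → α j ≤ α i)
    (hconst : ∀ i : Fin n, u ≤ (i : ℕ) → α i = 1)
    (hstrict : ∀ i : Fin n, (i : ℕ) < u → 1 < α i)
    (N : ℕ) (hN : N = ∏ i, p i ^ α i)
    (P : ℕ) (hP : P = ∏ i ∈ Finset.univ.filter (fun i : Fin n => u ≤ (i : ℕ)), p i)
    (D : Finset ℕ) (hD : IsMaxNSet N D)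
    (hcard : D.card = α ⟨n - 1, by omega⟩ *
      ∏ i ∈ Finset.univ.erase ⟨n - 1, by omega⟩, (α i + 1)) :
    ∀ d ∈ dSet D, d ∣ P := by
  have hN0 : N ≠ 0 := hN ▸ Finset.prod_ne_zero_iff.2 fun i _ => pow_ne_zero _ (hp i).ne_zero
  have hlast : α ⟨n - 1, by omega⟩ = 1 := hconst _ (Nat.le_sub_one_of_lt hu)
  have hhalf : N.divisors.card = 2 * D.card := by
    rw [hN, card_divisors_prod_primes_pow _ p α hp hinj, hcard, hlast, Nat.one_mul,
      ← Finset.mul_prod_erase _ _ (Finset.mem_univ (⟨n - 1, by omega⟩ : Fin n)), hlast]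
  intro d hd
  have hdN : d ∣ N := hD.1.1 d (Finset.mem_filter.1 hd).1
  have hsq : ∀ q, q.Prime → q ∣ d → ¬ q * q ∣ N := fun q hq hqd =>
    hD.not_sq_dvd_of_mem_dSet hN0 hhalf hd hq hqd
  refine Squarefree.dvd_of_forall_prime_dvd (Nat.squarefree_iff_prime_squarefree.2
    fun q hq h => hsq q hq ((Dvd.intro _ rfl).trans h) (h.trans hdN)) fun q hq hqd => ?_
  obtain ⟨i, -, hi⟩ := hq.prime.exists_mem_finset_dvd (hN ▸ hqd.trans hdN)
  obtain rfl : q = p i := (Nat.prime_dvd_prime_iff_eq hq (hp i)).1 (hq.dvd_of_dvd_pow hi)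
  have hui : u ≤ (i : ℕ) := by
    by_contra! hiu
    refine hsq _ hq hqd ?_
    rw [← pow_two, hN]
    exact (pow_dvd_pow _ (hstrict i hiu)).trans
      (Finset.dvd_prod_of_mem (fun i => p i ^ α i) (Finset.mem_univ i))
  rw [hP]
  exact Finset.dvd_prod_of_mem p (Finset.mem_filter.2 ⟨Finset.mem_univ i, hui⟩)
end

section
/- Let p_1, ..., p_n be distinct primes, let α_1 ≥ α_2 ≥ ... ≥ α_u > α_{u+1} = ... = α_n = 1 (with u = 0 if all α_i equal 1), and let N = p_1^{α_1}···p_n^{α_n}. A set D of positive divisors of N is a maximal N-set of minimum size (i.e. |D| = α_n · ∏_{i=1}^{n-1} (α_i + 1)) if and only if D = R(T, N) for some set T of positive divisors of p_{u+1}···p_n such that: (a) no two elements of T are coprime; (b) no element of T divides another element of T; and (c) every divisor of p_{u+1}···p_n is either coprime to some element of T or divisible by some element of T. -/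
open Finset

/-- The involution on the divisors of `N` exchanging, at every prime, the exponents `0` and
`N.factorization p` and leaving all other exponents unchanged. -/
noncomputable def exponentSwap (N l : ℕ) : ℕ :=
  (Finsupp.zipWith (fun a b => Equiv.swap 0 a b) (by simp) N.factorization l.factorization).prod
    (· ^ ·)

lemma factorization_exponentSwap (N l q : ℕ) :
    (exponentSwap N l).factorization q =
      Equiv.swap 0 (N.factorization q) (l.factorization q) := by
  unfold exponentSwap
  rw [Nat.prod_pow_factorization_eq_self]
  · simp [Finsupp.zipWith_apply]
  · intro q hq
    by_contra h
    simp [Finsupp.zipWith_apply, Nat.factorization_eq_zero_of_not_prime _ h] at hq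

lemma exponentSwap_ne_zero (N l : ℕ) : exponentSwap N l ≠ 0 := by
  unfold exponentSwap
  refine Finset.prod_ne_zero_iff.2 fun q hq => pow_ne_zero _ ?_
  rintro rfl
  simp [Finsupp.zipWith_apply] at hq

lemma exponentSwap_dvd {N l : ℕ} (hN : N ≠ 0) (hl : l ∣ N) : exponentSwap N l ∣ N := by
  rw [← Nat.factorization_le_iff_dvd (exponentSwap_ne_zero N l) hN]
  intro q
  rw [factorization_exponentSwap]
  have := (Nat.factorization_le_iff_dvd (ne_zero_of_dvd_ne_zero hN hl) hN).2 hl q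
  rw [Equiv.swap_apply_def]
  split_ifs <;> omega

lemma exponentSwap_exponentSwap {N l : ℕ} (hl : l ≠ 0) :
    exponentSwap N (exponentSwap N l) = l := by
  refine Nat.eq_of_factorization_eq (exponentSwap_ne_zero _ _) hl fun q => ?_
  simp [factorization_exponentSwap]

lemma dvd_iff_factorization_ne_zero {q l : ℕ} (hq : q.Prime) (hl : l ≠ 0) :
    q ∣ l ↔ l.factorization q ≠ 0 := by
  rw [hq.dvd_iff_one_le_factorization hl]
  omega

lemma dvd_exponentSwap {N l q : ℕ} (hq : q.Prime) (hN : N ≠ 0) (hl : l ≠ 0) (hqN : q ∣ N)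
    (h : ¬ q ∣ l) : q ∣ exponentSwap N l := by
  rw [dvd_iff_factorization_ne_zero hq hl, not_not] at h
  rw [dvd_iff_factorization_ne_zero hq (exponentSwap_ne_zero _ _), factorization_exponentSwap, h,
    Equiv.swap_apply_left]
  exact (dvd_iff_factorization_ne_zero hq hN).1 hqN

lemma IsMaxNSet.mem_of_primes {N d l : ℕ} {D : Finset ℕ} (hD : IsMaxNSet N D) (hd : d ∈ D)
    (hl : l ∣ N) (h : ∀ q : ℕ, q.Prime → q ∣ d → q ∣ l) : l ∈ D := by
  by_contra hlD
  obtain ⟨e, he, hle⟩ := hD.2 l hl hlD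
  refine hD.1.2 d hd e he (Nat.Coprime.gcd_eq_one ?_)
  refine Nat.coprime_of_dvd fun q hq hqd hqe => ?_
  exact hq.not_dvd_one (hle ▸ Nat.dvd_gcd (h q hq hqd) hqe)

/-- If `m` divides `N` and is not in the maximal set `D`, then every divisor of `N` divisible by
all primes of `N` not dividing `m` is in `D`. -/
lemma IsMaxNSet.mem_of_notMem {N m l : ℕ} {D : Finset ℕ} (hD : IsMaxNSet N D) (hm : m ∣ N)
    (hmD : m ∉ D) (hl : l ∣ N) (h : ∀ q : ℕ, q.Prime → q ∣ N → ¬ q ∣ m → q ∣ l) : l ∈ D := by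
  obtain ⟨e, he, hme⟩ := hD.2 m hm hmD
  refine hD.mem_of_primes he hl fun q hq hqe => h q hq (hqe.trans (hD.1.1 e he)) fun hqm => ?_
  exact hq.not_dvd_one (hme ▸ Nat.dvd_gcd hqm hqe)

lemma IsMaxNSet.exponentSwap_mem {N l : ℕ} {D : Finset ℕ} (hN : N ≠ 0) (hD : IsMaxNSet N D)
    (hl : l ∣ N) (hlD : l ∉ D) : exponentSwap N l ∈ D :=
  hD.mem_of_notMem hl hlD (exponentSwap_dvd hN hl) fun _ hq hqN hql =>
    dvd_exponentSwap hq hN (ne_zero_of_dvd_ne_zero hN hl) hqN hql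

lemma IsMaxNSet.two_mul_card_eq_iff {N : ℕ} {D : Finset ℕ} (hN : N ≠ 0) (hD : IsMaxNSet N D) :
    2 * D.card = N.divisors.card ↔ ∀ d ∈ D, exponentSwap N d ∉ D := by
  have hsub : D ⊆ N.divisors := fun d hd => Nat.mem_divisors.2 ⟨hD.1.1 d hd, hN⟩
  have hne : ∀ d ∈ N.divisors, d ≠ 0 := fun d hd =>
    ne_zero_of_dvd_ne_zero hN (Nat.dvd_of_mem_divisors hd)
  have hinj : Set.InjOn (exponentSwap N) (N.divisors : Set ℕ) := fun a ha b hb hab => by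
    rw [← exponentSwap_exponentSwap (N := N) (hne a ha), hab, exponentSwap_exponentSwap (hne b hb)]
  have hcard := Finset.card_sdiff_add_card_eq_card hsub
  have himg : (N.divisors \ D).image (exponentSwap N) ⊆ D := by
    intro x hx
    obtain ⟨l, hl, rfl⟩ := Finset.mem_image.1 hx
    rw [Finset.mem_sdiff, Nat.mem_divisors] at hl
    exact hD.exponentSwap_mem hN hl.1.1 hl.2
  have hcardimg : ((N.divisors \ D).image (exponentSwap N)).card = (N.divisors \ D).card :=
    Finset.card_image_of_injOn (hinj.mono (by simp))
  constructor
  · intro h d hd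
    have heq := Finset.eq_of_subset_of_card_le himg (by omega)
    rw [← heq] at hd
    obtain ⟨l, hl, rfl⟩ := Finset.mem_image.1 hd
    rw [Finset.mem_sdiff] at hl
    rw [exponentSwap_exponentSwap (hne l hl.1)]
    exact hl.2
  · intro h
    have hle : D.card ≤ (N.divisors \ D).card := by
      refine Finset.card_le_card_of_injOn (exponentSwap N) (fun d hd => ?_)
        (hinj.mono (by exact_mod_cast hsub))
      exact Finset.mem_coe.2 (Finset.mem_sdiff.2
        ⟨Nat.mem_divisors.2 ⟨exponentSwap_dvd hN (hD.1.1 d hd), hN⟩, h d hd⟩)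
    have := Finset.card_le_card himg
    omega

lemma exists_mem_dSet_dvd {D : Finset ℕ} {d : ℕ} (h0 : 0 ∉ D) (hd : d ∈ D) :
    ∃ t ∈ dSet D, t ∣ d := by
  induction d using Nat.strong_induction_on with
  | _ d ih =>
    by_cases h : ∀ e ∈ D, e ∣ d → e = d
    · exact ⟨d, Finset.mem_filter.2 ⟨hd, h⟩, dvd_rfl⟩
    · push Not at h
      obtain ⟨e, he, hed, hne⟩ := h
      have hpos : 0 < d := Nat.pos_of_ne_zero fun h => h0 (h ▸ hd)
      obtain ⟨t, ht, hte⟩ := ih e (lt_of_le_of_ne (Nat.le_of_dvd hpos hed) hne) he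
      exact ⟨t, ht, hte.trans hed⟩

/-- Minimal elements of a maximal `N`-set are squarefree. -/
lemma IsMaxNSet.squarefree_of_mem_dSet {N t : ℕ} {D : Finset ℕ} (hN : N ≠ 0)
    (hD : IsMaxNSet N D) (ht : t ∈ dSet D) : Squarefree t := by
  obtain ⟨htD, hmin⟩ := Finset.mem_filter.1 ht
  have htN := hD.1.1 t htD
  have ht0 := ne_zero_of_dvd_ne_zero hN htN
  have hrad : ∏ r ∈ t.primeFactors, r ∣ t := Nat.prod_primeFactors_dvd t
  have hmem : ∏ r ∈ t.primeFactors, r ∈ D := hD.mem_of_primes htD (hrad.trans htN)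
    fun r hr hrt => Finset.dvd_prod_of_mem _ (Nat.mem_primeFactors.2 ⟨hr, hrt, ht0⟩)
  rw [← hmin _ hmem hrad, ← Nat.radical_eq_prod_primeFactors]
  exact UniqueFactorizationMonoid.squarefree_radical

/-- A minimal element of a maximal `N`-set of half size only has primes of exponent one in `N`. -/
lemma IsMaxNSet.factorization_eq_one {N t q : ℕ} {D : Finset ℕ} (hN : N ≠ 0)
    (hD : IsMaxNSet N D) (hcard : 2 * D.card = N.divisors.card) (ht : t ∈ dSet D)
    (hq : q.Prime) (hqt : q ∣ t) : N.factorization q = 1 := by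
  obtain ⟨htD, hmin⟩ := Finset.mem_filter.1 ht
  have htN := hD.1.1 t htD
  have ht0 := ne_zero_of_dvd_ne_zero hN htN
  have hone : t.factorization q = 1 :=
    le_antisymm ((hD.squarefree_of_mem_dSet hN ht).natFactorization_le_one q)
      ((hq.dvd_iff_one_le_factorization ht0).1 hqt)
  by_contra hne
  refine (hD.two_mul_card_eq_iff hN).1 hcard t htD ?_
  have hdvd : t / q ∣ t := Nat.div_dvd_of_dvd hqt
  have hlt : t / q < t := Nat.div_lt_self (Nat.pos_of_ne_zero ht0) hq.one_lt
  refine hD.mem_of_notMem (hdvd.trans htN) (fun h => hlt.ne (hmin _ h hdvd))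
    (exponentSwap_dvd hN htN) fun r hr hrN hrt => ?_
  by_cases hrq : r = q
  · subst hrq
    rw [dvd_iff_factorization_ne_zero hr (exponentSwap_ne_zero _ _), factorization_exponentSwap,
      hone, Equiv.swap_apply_of_ne_of_ne one_ne_zero (Ne.symm hne)]
    exact one_ne_zero
  · refine dvd_exponentSwap hr hN ht0 hrN fun hrt' => hrt ?_
    rw [← Nat.mul_div_cancel' hqt] at hrt'
    exact (hr.dvd_mul.1 hrt').resolve_left fun h => hrq ((Nat.prime_dvd_prime_iff_eq hr hq).1 h)

/-- Here `P` is the product of the primes of exponent one in `N`. -/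
lemma isMaxNSet_half_card_iff {N P : ℕ} {D : Finset ℕ} (hN : N ≠ 0) (hP : P ≠ 0)
    (hfac : ∀ q, P.factorization q = if N.factorization q = 1 then 1 else 0) :
    (IsMaxNSet N D ∧ 2 * D.card = N.divisors.card) ↔
      ∃ T : Finset ℕ, (∀ t ∈ T, t ∣ P) ∧
        (∀ t ∈ T, ∀ t' ∈ T, Nat.gcd t t' ≠ 1) ∧
        (∀ t ∈ T, ∀ t' ∈ T, t ∣ t' → t = t') ∧
        (∀ l, l ∣ P → (∃ t ∈ T, Nat.gcd l t = 1) ∨ (∃ t ∈ T, t ∣ l)) ∧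
        D = RSet T N := by
  have hPN : P ∣ N := by
    rw [← Nat.factorization_le_iff_dvd hP hN]
    intro q
    rw [hfac]
    split_ifs <;> omega
  constructor
  · rintro ⟨hD, hcard⟩
    have h0 : 0 ∉ D := fun h => hN (zero_dvd_iff.1 (hD.1.1 0 h))
    have hsub : ∀ t ∈ dSet D, t ∈ D := fun t ht => (Finset.mem_filter.1 ht).1
    refine ⟨dSet D, fun t ht => ?_, fun t ht t' ht' => hD.1.2 t (hsub t ht) t' (hsub t' ht'),
      fun t ht t' ht' h => (Finset.mem_filter.1 ht').2 t (hsub t ht) h, fun l hl => ?_, ?_⟩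
    · have ht0 : t ≠ 0 := fun h => h0 (h ▸ hsub t ht)
      rw [← Nat.factorization_le_iff_dvd ht0 hP]
      intro q
      rw [hfac]
      split_ifs with h
      · exact (hD.squarefree_of_mem_dSet hN ht).natFactorization_le_one q
      · by_contra hlt
        have hq : q.Prime := by
          by_contra hq
          simp [Nat.factorization_eq_zero_of_not_prime _ hq] at hlt
        exact h (hD.factorization_eq_one hN hcard ht hq
          ((dvd_iff_factorization_ne_zero hq ht0).2 (by omega)))
    · by_cases hlD : l ∈ D
      · exact Or.inr (exists_mem_dSet_dvd h0 hlD)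
      · obtain ⟨d, hd, hld⟩ := hD.2 l (hl.trans hPN) hlD
        obtain ⟨t, ht, htd⟩ := exists_mem_dSet_dvd h0 hd
        exact Or.inl ⟨t, ht, Nat.Coprime.coprime_dvd_right htd hld⟩
    · ext l
      simp only [RSet, Finset.mem_filter, Nat.mem_divisors]
      constructor
      · exact fun hl => ⟨⟨hD.1.1 l hl, hN⟩, exists_mem_dSet_dvd h0 hl⟩
      · rintro ⟨⟨hl, -⟩, t, ht, htl⟩
        exact hD.mem_of_primes (hsub t ht) hl fun q _ hqt => hqt.trans htl
  · rintro ⟨T, hTP, hinter, -, hmax, rfl⟩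
    have hmem : ∀ l, l ∈ RSet T N ↔ l ∣ N ∧ ∃ t ∈ T, t ∣ l := fun l => by simp [RSet, hN]
    have hD : IsMaxNSet N (RSet T N) := by
      refine ⟨⟨fun d hd => ((hmem d).1 hd).1, fun d hd e he hde => ?_⟩, fun l hl hlD => ?_⟩
      · obtain ⟨-, t, ht, htd⟩ := (hmem d).1 hd
        obtain ⟨-, t', ht', hte⟩ := (hmem e).1 he
        exact hinter t ht t' ht' (Nat.Coprime.of_dvd htd hte hde)
      · rcases hmax (Nat.gcd l P) (Nat.gcd_dvd_right l P) with ⟨t, ht, htl⟩ | ⟨t, ht, htl⟩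
        · refine ⟨t, (hmem t).2 ⟨(hTP t ht).trans hPN, t, ht, dvd_rfl⟩, ?_⟩
          rwa [Nat.gcd_assoc, Nat.gcd_eq_right (hTP t ht)] at htl
        · exact absurd ((hmem l).2 ⟨hl, t, ht, htl.trans (Nat.gcd_dvd_left l P)⟩) hlD
    refine ⟨hD, (hD.two_mul_card_eq_iff hN).2 fun d hd hsd => ?_⟩
    obtain ⟨hdN, t, ht, htd⟩ := (hmem d).1 hd
    obtain ⟨-, t', ht', hts⟩ := (hmem _).1 hsd
    have hd0 := ne_zero_of_dvd_ne_zero hN hdN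
    refine hinter t ht t' ht' (Nat.Coprime.gcd_eq_one (Nat.coprime_of_dvd fun q hq hqt hqt' => ?_))
    have h1 : N.factorization q = 1 := by
      have := (dvd_iff_factorization_ne_zero hq hP).1 (hqt.trans (hTP t ht))
      rw [hfac] at this
      by_contra h
      simp [h] at this
    have h2 := (dvd_iff_factorization_ne_zero hq hd0).1 (hqt.trans htd)
    have h3 := (dvd_iff_factorization_ne_zero hq (exponentSwap_ne_zero _ _)).1 (hqt'.trans hts)
    have h4 := (Nat.factorization_le_iff_dvd hd0 hN).2 hdN q
    have h5 : d.factorization q = 1 := by omega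
    simp [factorization_exponentSwap, h1, h5] at h3

lemma factorization_prod_prime_pow_s5 {ι : Type*} [DecidableEq ι] (s : Finset ι) (p α : ι → ℕ)
    (hp : ∀ i, (p i).Prime) (q : ℕ) :
    (∏ i ∈ s, p i ^ α i).factorization q = ∑ i ∈ s, if p i = q then α i else 0 := by
  rw [Nat.factorization_prod fun i _ => pow_ne_zero _ (hp i).ne_zero, Finset.sum_apply']
  refine Finset.sum_congr rfl fun i _ => ?_
  rw [(hp i).factorization_pow, Finsupp.single_apply]

lemma card_divisors_prod_prime_pow {ι : Type*} [DecidableEq ι] (s : Finset ι) (p α : ι → ℕ)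
    (hp : ∀ i, (p i).Prime) (hinj : Function.Injective p) :
    (∏ i ∈ s, p i ^ α i).divisors.card = ∏ i ∈ s, (α i + 1) := by
  induction s using Finset.induction_on with
  | empty => simp
  | insert a s ha ih =>
    rw [Finset.prod_insert ha, Finset.prod_insert ha, Nat.Coprime.card_divisors_mul, ih,
      Nat.divisors_prime_pow (hp a), Finset.card_map, Finset.card_range]
    refine Nat.Coprime.prod_right fun i hi => Nat.Coprime.pow _ _ ?_
    exact (Nat.coprime_primes (hp a) (hp i)).2 fun h => ha (hinj h ▸ hi)

/-- **Theorem 3.** With `α₁ ≥ ⋯ ≥ α_u > α_{u+1} = ⋯ = α_n = 1` (0-indexed),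
`N = p₁^{α₁} ⋯ p_n^{α_n}` and `P = p_{u+1} ⋯ p_n`: a set `D` of positive divisors of
`N` is a maximal `N`-set of minimum size `α_n ∏_{i=1}^{n-1} (α_i + 1)` if and only if
`D = R(T, N)` for some set `T` of positive divisors of `P` such that (a) no two
elements of `T` are coprime, (b) no element of `T` divides another element of `T`,
and (c) every divisor of `P` is either coprime to some element of `T` or divisible by
some element of `T`. -/
theorem stmt_5 (n u : ℕ) (hu : u < n) (p α : Fin n → ℕ)
    (hp : ∀ i, (p i).Prime) (hinj : Function.Injective p)
    (hanti : ∀ i j : Fin n, i ≤ j → α j ≤ α i)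
    (hconst : ∀ i : Fin n, u ≤ (i : ℕ) → α i = 1)
    (hstrict : ∀ i : Fin n, (i : ℕ) < u → 1 < α i)
    (N : ℕ) (hN : N = ∏ i, p i ^ α i)
    (P : ℕ) (hP : P = ∏ i ∈ Finset.univ.filter (fun i : Fin n => u ≤ (i : ℕ)), p i)
    (D : Finset ℕ) (hDdvd : ∀ d ∈ D, d ∣ N) :
    (IsMaxNSet N D ∧
        D.card = α ⟨n - 1, by omega⟩ *
          ∏ i ∈ Finset.univ.erase ⟨n - 1, by omega⟩, (α i + 1)) ↔
      ∃ T : Finset ℕ, (∀ t ∈ T, t ∣ P) ∧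
        (∀ t ∈ T, ∀ t' ∈ T, Nat.gcd t t' ≠ 1) ∧
        (∀ t ∈ T, ∀ t' ∈ T, t ∣ t' → t = t') ∧
        (∀ l, l ∣ P → (∃ t ∈ T, Nat.gcd l t = 1) ∨ (∃ t ∈ T, t ∣ l)) ∧
        D = RSet T N := by
  have hN0 : N ≠ 0 := hN ▸ Finset.prod_ne_zero_iff.2 fun i _ => pow_ne_zero _ (hp i).ne_zero
  have hP0 : P ≠ 0 := hP ▸ Finset.prod_ne_zero_iff.2 fun i _ => (hp i).ne_zero
  have hfac : ∀ q, P.factorization q = if N.factorization q = 1 then 1 else 0 := by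
    intro q
    have hNq := factorization_prod_prime_pow_s5 Finset.univ p α hp q
    have hPq := factorization_prod_prime_pow_s5
      (Finset.univ.filter fun i : Fin n => u ≤ (i : ℕ)) p (fun _ => 1) hp q
    simp only [pow_one] at hPq
    rw [← hN] at hNq
    rw [← hP] at hPq
    rw [hNq, hPq]
    by_cases hq : ∃ j, p j = q
    · obtain ⟨j, rfl⟩ := hq
      simp only [hinj.eq_iff, Finset.sum_ite_eq', Finset.mem_univ, Finset.mem_filter, true_and,
        if_true]
      by_cases hj : u ≤ (j : ℕ)
      · simp [hj, hconst j hj]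
      · simp [hj, (hstrict j (not_le.1 hj)).ne']
    · push Not at hq
      simp [hq]
  have hα : α ⟨n - 1, by omega⟩ = 1 := hconst _ (by simp only; omega)
  have hcard : N.divisors.card =
      2 * ∏ i ∈ Finset.univ.erase (⟨n - 1, by omega⟩ : Fin n), (α i + 1) := by
    rw [hN, card_divisors_prod_prime_pow _ p α hp hinj,
      ← Finset.mul_prod_erase _ _ (Finset.mem_univ (⟨n - 1, by omega⟩ : Fin n)), hα]
  rw [← isMaxNSet_half_card_iff hN0 hP0 hfac, hcard, hα, one_mul]
  exact and_congr_right fun _ => by omega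
end

section
/- Let p_1, ..., p_n be distinct primes, let α_1 ≥ α_2 ≥ ... ≥ α_u > α_{u+1} = ... = α_n ≥ 2 (with u = 0 if all α_i are equal), and let N = p_1^{α_1}···p_n^{α_n}. Then the number of maximal N-sets of minimum size (i.e. with |D| = α_n · ∏_{i=1}^{n-1} (α_i + 1)) equals n - u. -/
open Finset

section Exponents

variable {ι : Type*} [Fintype ι] {α : ι → ℕ}

/-- A maximal family of exponent vectors any two of which have a common nonzero coordinate. -/
structure IsMaxIntersecting_s7 (X : Finset (∀ i, ZMod (α i + 1))) : Prop where
  exists_common : ∀ e ∈ X, ∀ f ∈ X, ∃ i, e i ≠ 0 ∧ f i ≠ 0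
  exists_disjoint : ∀ e, e ∉ X → ∃ f ∈ X, ∀ i, f i ≠ 0 → e i = 0

lemma natCast_zmod_inj {m k l : ℕ} (hk : k ≤ m) (hl : l ≤ m)
    (h : (k : ZMod (m + 1)) = l) : k = l := by
  rw [← ZMod.val_natCast_of_lt (Nat.lt_succ_of_le hk), h,
    ZMod.val_natCast_of_lt (Nat.lt_succ_of_le hl)]

/-- If `X` has the extremal size, then every partial colouring of the coordinates has a colour class
containing the support of a member of `X`. -/
lemma IsMaxIntersecting_s7.exists_support_subset_level {X : Finset (∀ i, ZMod (α i + 1))}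
    (hX : IsMaxIntersecting_s7 X) {a : ℕ} (ha : ∀ i, a ≤ α i)
    (hcard : X.card * (a + 1) = a * ∏ i, (α i + 1)) (m : ι → ℕ) (hm : ∀ i, m i ≤ α i) :
    ∃ f ∈ X, ∃ k ≤ a, ∀ i, f i ≠ 0 → m i = k := by
  classical
  let g : {e // e ∉ X} × Fin (a + 1) → ∀ i, ZMod (α i + 1) := fun x i => x.1.1 i + (x.2.1 : ℕ)
  have hg : Function.Injective g := by
    rintro ⟨⟨e, he⟩, k, hk⟩ ⟨⟨e', he'⟩, k', hk'⟩ h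
    have hi : ∀ i, e i + (k : ZMod (α i + 1)) = e' i + (k' : ZMod (α i + 1)) := congrFun h
    obtain ⟨f, hf, hef⟩ := hX.exists_disjoint e he
    obtain ⟨f', hf', hef'⟩ := hX.exists_disjoint e' he'
    obtain ⟨i, h1, h2⟩ := hX.exists_common f hf f' hf'
    have hki := hi i
    rw [hef i h1, hef' i h2, zero_add, zero_add] at hki
    obtain rfl : k = k' := natCast_zmod_inj (by have := ha i; omega) (by have := ha i; omega) hki
    obtain rfl : e = e' := funext fun i => add_right_cancel (hi i)
    rfl
  have hE : Fintype.card (∀ i, ZMod (α i + 1)) = ∏ i, (α i + 1) := by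
    simp [Fintype.card_pi, ZMod.card]
  have hC : Fintype.card {e // e ∉ X} + X.card = ∏ i, (α i + 1) := by
    rw [← hE, Fintype.card_subtype_compl, Fintype.card_coe]
    exact Nat.sub_add_cancel X.card_le_univ
  have hsurj : Function.Surjective g := by
    refine ((Fintype.bijective_iff_injective_and_card g).2 ⟨hg, ?_⟩).2
    rw [Fintype.card_prod, Fintype.card_fin, hE]
    rw [← hC] at hcard ⊢
    linarith
  obtain ⟨⟨⟨e, he⟩, k, hk⟩, h⟩ := hsurj fun i => (m i : ZMod (α i + 1))
  obtain ⟨f, hf, hef⟩ := hX.exists_disjoint e he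
  refine ⟨f, hf, k, by omega, fun i hfi => ?_⟩
  have hki : e i + (k : ZMod (α i + 1)) = (m i : ZMod (α i + 1)) := congrFun h i
  rw [hef i hfi, zero_add] at hki
  exact (natCast_zmod_inj (by have := ha i; omega) (hm i) hki).symm

/-- A maximal intersecting family of the extremal size consists of the vectors that do not vanish
at a fixed coordinate whose range is smallest. -/
lemma IsMaxIntersecting_s7.exists_eq_star {X : Finset (∀ i, ZMod (α i + 1))}
    (hX : IsMaxIntersecting_s7 X) {a : ℕ} (h2 : 2 ≤ a) (ha : ∀ i, a ≤ α i)
    (hcard : X.card * (a + 1) = a * ∏ i, (α i + 1)) :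
    ∃ i, α i = a ∧ ∀ e, e ∈ X ↔ e i ≠ 0 := by
  classical
  have hlevel := fun m hm => hX.exists_support_subset_level ha hcard m hm
  have hne : ∀ f ∈ X, ∃ i, f i ≠ 0 := fun f hf =>
    (hX.exists_common f hf f hf).imp fun _ h => h.1
  let supp : (∀ i, ZMod (α i + 1)) → Finset ι := fun f => univ.filter fun i => f i ≠ 0
  have hsmall : ∃ f ∈ X, ∀ i, f i ≠ 0 → α i = a := by
    obtain ⟨f, hf, k, hk, h⟩ := hlevel (fun i => if α i = a then 0 else a + 1) fun i => by
      have := ha i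
      split_ifs <;> omega
    refine ⟨f, hf, fun i hi => ?_⟩
    by_contra hc
    have := h i hi
    rw [if_neg hc] at this
    omega
  obtain ⟨f, hf, hmin⟩ := exists_min_image
    (X.filter fun f => ∀ i, f i ≠ 0 → α i = a) (fun f => (supp f).card)
    (hsmall.imp fun f hf => mem_filter.2 hf)
  obtain ⟨hfX, hfa⟩ := mem_filter.1 hf
  obtain ⟨i, hi⟩ := hne f hfX
  have hsing : ∀ j, f j ≠ 0 → j = i := by
    by_contra! hc
    obtain ⟨j, hj, hji⟩ := hc
    have hlt : ∀ f' ∈ X, (∀ l, f' l ≠ 0 → f l ≠ 0) → ∀ j, f j ≠ 0 → f' j ≠ 0 := by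
      intro f' hf' hsub j hj hj'
      have hle := hmin f' (mem_filter.2 ⟨hf', fun l hl => hfa l (hsub l hl)⟩)
      refine absurd (card_lt_card (s := supp f') (t := supp f) ?_) (not_lt.2 hle)
      refine (ssubset_iff_of_subset fun l hl => ?_).2 ⟨j, ?_, ?_⟩
      · simp only [supp, mem_filter, mem_univ, true_and] at hl ⊢
        exact hsub l hl
      · simpa [supp] using hj
      · simpa [supp] using hj'
    obtain ⟨f', hf', k, hk, h⟩ := hlevel
      (fun l => if l = i then 0 else if f l ≠ 0 then 1 else if α l = a then 2 else a + 1)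
      fun l => by
        have := ha l
        split_ifs <;> omega
    obtain ⟨l, hl, hl'⟩ := hX.exists_common f hfX f' hf'
    have hkl := h l hl'
    have hsub : ∀ l, f' l ≠ 0 → f l ≠ 0 := by
      intro q hq hq0
      have hkq := h q hq
      have hqi : q ≠ i := fun hqi => hi (hqi ▸ hq0)
      simp only [hl, hq0, hqi, if_false, ne_eq, not_true_eq_false, not_false_eq_true,
        if_true] at hkl hkq
      split_ifs at hkl hkq <;> omega
    have hki := h i (hlt f' hf' hsub i hi)
    have hkj := h j (hlt f' hf' hsub j hj)
    simp only [hji, hj, if_true, if_false, ne_eq, not_false_eq_true] at hki hkj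
    omega
  have hstar : ∀ e ∈ X, e i ≠ 0 := by
    intro e he
    obtain ⟨j, hj, hej⟩ := hX.exists_common f hfX e he
    exact hsing j hj ▸ hej
  refine ⟨i, hfa i hi, fun e => ⟨hstar e, fun he => ?_⟩⟩
  by_contra hc
  obtain ⟨d, hd, hde⟩ := hX.exists_disjoint e hc
  exact he (hde i (hstar d hd))

lemma card_star_mul [DecidableEq ι] (i : ι) :
    (univ.filter fun e : ∀ i, ZMod (α i + 1) => e i ≠ 0).card =
      α i * ∏ j ∈ univ.erase i, (α j + 1) := by
  have h : (univ.filter fun e : ∀ i, ZMod (α i + 1) => e i ≠ 0) =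
      Fintype.piFinset (Function.update (fun _ => univ) i (univ.erase 0)) := by
    ext e
    simp only [mem_filter, mem_univ, true_and, Fintype.mem_piFinset]
    refine ⟨fun h j => ?_, fun h => ?_⟩
    · by_cases hj : j = i
      · subst hj
        simpa using h
      · simp [Function.update_of_ne hj]
    · simpa using h i
  rw [h, Fintype.card_piFinset, ← mul_prod_erase univ _ (mem_univ i)]
  congr 1
  · simp [card_erase_of_mem, ZMod.card]
  · refine prod_congr rfl fun j hj => ?_
    rw [Function.update_of_ne (ne_of_mem_erase hj), card_univ, ZMod.card]

/-- The number with exponent vector `e` with respect to the primes `p`. -/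
def ofExponents (p : ι → ℕ) (e : ∀ i, ZMod (α i + 1)) : ℕ := ∏ i, p i ^ (e i).val

variable {p : ι → ℕ}

lemma factorization_prod_primes_pow (hp : ∀ i, (p i).Prime) (hinj : Function.Injective p)
    (b : ι → ℕ) (i : ι) : (∏ j, p j ^ b j).factorization (p i) = b i := by
  classical
  rw [Nat.factorization_prod_apply fun j _ => pow_ne_zero _ (hp j).ne_zero,
    sum_eq_single i]
  · simp [(hp i).factorization]
  · intro j _ hj
    simp [(hp j).factorization, hinj.ne hj]
  · simp

lemma ofExponents_ne_zero (hp : ∀ i, (p i).Prime) (e : ∀ i, ZMod (α i + 1)) :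
    ofExponents p e ≠ 0 := prod_ne_zero_iff.2 fun i _ => pow_ne_zero _ (hp i).ne_zero

lemma dvd_ofExponents_iff (hp : ∀ i, (p i).Prime) (hinj : Function.Injective p)
    (e : ∀ i, ZMod (α i + 1)) (i : ι) : p i ∣ ofExponents p e ↔ e i ≠ 0 := by
  rw [(hp i).dvd_iff_one_le_factorization (ofExponents_ne_zero hp e), ofExponents,
    factorization_prod_primes_pow hp hinj, Nat.one_le_iff_ne_zero, Ne, ZMod.val_eq_zero]

lemma ofExponents_injective (hp : ∀ i, (p i).Prime) (hinj : Function.Injective p) :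
    Function.Injective (ofExponents (α := α) p) := by
  intro e f h
  funext i
  apply ZMod.val_injective
  rw [← factorization_prod_primes_pow hp hinj (fun j => (e j).val) i,
    ← factorization_prod_primes_pow hp hinj (fun j => (f j).val) i]
  exact congrArg (fun m => m.factorization (p i)) h

lemma ofExponents_dvd (e : ∀ i, ZMod (α i + 1)) : ofExponents p e ∣ ∏ i, p i ^ α i :=
  prod_dvd_prod_of_dvd _ _ fun i _ => pow_dvd_pow _ (Nat.le_of_lt_succ (ZMod.val_lt (e i)))

lemma exists_prime_dvd_prod {p : ι → ℕ} (hp : ∀ i, (p i).Prime) (b : ι → ℕ) {q : ℕ}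
    (hq : q.Prime) (h : q ∣ ∏ i, p i ^ b i) : ∃ i, q = p i := by
  obtain ⟨i, -, hi⟩ := (hq.prime.dvd_finsetProd_iff _).1 h
  exact ⟨i, (Nat.prime_dvd_prime_iff_eq hq (hp i)).1 (hq.dvd_of_dvd_pow hi)⟩

lemma exists_ofExponents_eq (hp : ∀ i, (p i).Prime) (hinj : Function.Injective p) {l : ℕ}
    (hl : l ∣ ∏ i, p i ^ α i) : ∃ e : ∀ i, ZMod (α i + 1), ofExponents p e = l := by
  have hN : ∏ i, p i ^ α i ≠ 0 := prod_ne_zero_iff.2 fun i _ => pow_ne_zero _ (hp i).ne_zero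
  have hl0 : l ≠ 0 := ne_zero_of_dvd_ne_zero hN hl
  refine ⟨fun i => (l.factorization (p i) : ℕ), ?_⟩
  have hle : ∀ i, l.factorization (p i) ≤ α i := fun i => by
    rw [← factorization_prod_primes_pow hp hinj α i]
    exact (Nat.factorization_le_iff_dvd hl0 hN).2 hl (p i)
  have heq : ofExponents p (fun i => ((l.factorization (p i) : ℕ) : ZMod (α i + 1))) =
      ∏ i, p i ^ l.factorization (p i) :=
    prod_congr rfl fun i _ => by rw [ZMod.val_natCast_of_lt (Nat.lt_succ_of_le (hle i))]
  rw [heq]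
  refine Nat.eq_of_factorization_eq
    (prod_ne_zero_iff.2 fun i _ => pow_ne_zero _ (hp i).ne_zero) hl0 fun q => ?_
  by_cases hq : ∃ i, q = p i
  · obtain ⟨i, rfl⟩ := hq
    exact factorization_prod_primes_pow hp hinj _ i
  · by_cases hqp : q.Prime
    · rw [Nat.factorization_eq_zero_of_not_dvd fun h => hq (exists_prime_dvd_prod hp _ hqp h),
        Nat.factorization_eq_zero_of_not_dvd fun h =>
          hq (exists_prime_dvd_prod hp _ hqp (h.trans hl))]
    · rw [Nat.factorization_eq_zero_of_not_prime _ hqp, Nat.factorization_eq_zero_of_not_prime _ hqp]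

lemma gcd_ofExponents_ne_one_iff (hp : ∀ i, (p i).Prime) (hinj : Function.Injective p)
    (e f : ∀ i, ZMod (α i + 1)) :
    Nat.gcd (ofExponents p e) (ofExponents p f) ≠ 1 ↔ ∃ i, e i ≠ 0 ∧ f i ≠ 0 := by
  simp only [← dvd_ofExponents_iff hp hinj]
  rw [Nat.ne_one_iff_exists_prime_dvd]
  constructor
  · rintro ⟨q, hq, h⟩
    obtain ⟨i, rfl⟩ := exists_prime_dvd_prod hp _ hq
      ((h.trans (Nat.gcd_dvd_left _ _)).trans (ofExponents_dvd e))
    exact ⟨i, h.trans (Nat.gcd_dvd_left _ _), h.trans (Nat.gcd_dvd_right _ _)⟩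
  · rintro ⟨i, h, h'⟩
    exact ⟨p i, hp i, Nat.dvd_gcd h h'⟩

lemma IsMaxNSet.isMaxIntersecting_s7 [DecidableEq ι] (hp : ∀ i, (p i).Prime)
    (hinj : Function.Injective p) {D : Finset ℕ} (hD : IsMaxNSet (∏ i, p i ^ α i) D) :
    IsMaxIntersecting_s7 (univ.filter fun e : ∀ i, ZMod (α i + 1) => ofExponents p e ∈ D) where
  exists_common e he f hf := (gcd_ofExponents_ne_one_iff hp hinj e f).1
    (hD.1.2 _ (mem_filter.1 he).2 _ (mem_filter.1 hf).2)
  exists_disjoint e he := by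
    obtain ⟨d, hd, hed⟩ := hD.2 _ (ofExponents_dvd e) fun h => he (mem_filter.2 ⟨mem_univ _, h⟩)
    obtain ⟨f, rfl⟩ := exists_ofExponents_eq hp hinj (hD.1.1 d hd)
    refine ⟨f, mem_filter.2 ⟨mem_univ _, hd⟩, fun i hf => ?_⟩
    by_contra he
    exact (gcd_ofExponents_ne_one_iff hp hinj e f).2 ⟨i, he, hf⟩ hed

lemma card_filter_ofExponents_mem [DecidableEq ι] (hp : ∀ i, (p i).Prime)
    (hinj : Function.Injective p) {D : Finset ℕ} (hD : ∀ d ∈ D, d ∣ ∏ i, p i ^ α i) :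
    (univ.filter fun e : ∀ i, ZMod (α i + 1) => ofExponents p e ∈ D).card = D.card := by
  refine card_bij (fun e _ => ofExponents p e) (fun e he => (mem_filter.1 he).2)
    (fun e _ f _ h => ofExponents_injective hp hinj h) fun d hd => ?_
  obtain ⟨e, rfl⟩ := exists_ofExponents_eq hp hinj (hD d hd)
  exact ⟨e, mem_filter.2 ⟨mem_univ _, hd⟩, rfl⟩

end Exponents

lemma mem_RSet_singleton {N q l : ℕ} (hN : N ≠ 0) : l ∈ RSet {q} N ↔ l ∣ N ∧ q ∣ l := by
  simp [RSet, hN]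

lemma isMaxNSet_RSet_singleton {N q : ℕ} (hN : N ≠ 0) (hq : q.Prime) (hqN : q ∣ N) :
    IsMaxNSet N (RSet {q} N) := by
  simp only [IsMaxNSet, IsNSet, mem_RSet_singleton hN]
  refine ⟨⟨fun d hd => hd.1, fun d hd e he h => ?_⟩, fun l hl h => ⟨q, ⟨hqN, dvd_rfl⟩, ?_⟩⟩
  · exact hq.one_lt.ne' (Nat.dvd_one.1 (h ▸ Nat.dvd_gcd hd.2 he.2))
  · exact ((Nat.Prime.coprime_iff_not_dvd hq).2 fun hql => h ⟨hl, hql⟩).symm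

/-- Maximal `N`-sets of extremal size are the sets of divisors of `N` divisible by a fixed prime
of smallest exponent. -/
lemma isMaxNSet_and_card_iff {ι : Type*} [Fintype ι] [DecidableEq ι] {p α : ι → ℕ}
    (hp : ∀ i, (p i).Prime) (hinj : Function.Injective p) {a : ι} (h2 : 2 ≤ α a)
    (ha : ∀ i, α a ≤ α i) (D : Finset ℕ) :
    (IsMaxNSet (∏ i, p i ^ α i) D ∧ D.card = α a * ∏ i ∈ univ.erase a, (α i + 1)) ↔
      ∃ i, α i = α a ∧ RSet {p i} (∏ i, p i ^ α i) = D := by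
  have hN : ∏ i, p i ^ α i ≠ 0 := prod_ne_zero_iff.2 fun i _ => pow_ne_zero _ (hp i).ne_zero
  have hprod : ∀ i, (∏ j ∈ univ.erase i, (α j + 1)) * (α i + 1) = ∏ j, (α j + 1) := fun i =>
    prod_erase_mul univ _ (mem_univ i)
  constructor
  · rintro ⟨hD, hcard⟩
    obtain ⟨i, hi, h⟩ := (hD.isMaxIntersecting_s7 hp hinj).exists_eq_star h2 ha (by
      rw [card_filter_ofExponents_mem hp hinj hD.1.1, hcard, mul_assoc, hprod])
    refine ⟨i, hi, ext fun l => ?_⟩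
    rw [mem_RSet_singleton hN]
    by_cases hl : l ∣ ∏ i, p i ^ α i
    · obtain ⟨e, rfl⟩ := exists_ofExponents_eq hp hinj hl
      simpa [hl, dvd_ofExponents_iff hp hinj] using (h e).symm
    · exact iff_of_false (fun h => hl h.1) fun h => hl (hD.1.1 l h)
  · rintro ⟨i, hi, rfl⟩
    have hdvd : p i ∣ ∏ i, p i ^ α i :=
      (dvd_pow_self (p i) (by omega)).trans (dvd_prod_of_mem (fun i => p i ^ α i) (mem_univ i))
    refine ⟨isMaxNSet_RSet_singleton hN (hp i) hdvd, ?_⟩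
    rw [← card_filter_ofExponents_mem (α := α) hp hinj fun d hd =>
      ((mem_RSet_singleton hN).1 hd).1]
    have hset : (univ.filter fun e : ∀ i, ZMod (α i + 1) =>
        ofExponents p e ∈ RSet {p i} (∏ i, p i ^ α i)) = univ.filter fun e => e i ≠ 0 :=
      filter_congr fun e _ => by
        rw [mem_RSet_singleton hN, dvd_ofExponents_iff hp hinj, and_iff_right (ofExponents_dvd e)]
    rw [hset, card_star_mul, hi]
    congr 1
    refine Nat.eq_of_mul_eq_mul_right (Nat.succ_pos (α a)) ?_
    rw [Nat.succ_eq_add_one, hprod a, ← hi, hprod i]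

/-- With `α₁ ≥ ⋯ ≥ α_u > α_{u+1} = ⋯ = α_n ≥ 2` (0-indexed) and
`N = p₁^{α₁} ⋯ p_n^{α_n}`, the number of maximal `N`-sets of minimum size
`α_n ∏_{i=1}^{n-1} (α_i + 1)` equals `n - u`. -/
theorem stmt_7 (n u : ℕ) (hu : u < n) (p α : Fin n → ℕ)
    (hp : ∀ i, (p i).Prime) (hinj : Function.Injective p)
    (hanti : ∀ i j : Fin n, i ≤ j → α j ≤ α i)
    (hconst : ∀ i : Fin n, u ≤ (i : ℕ) → α i = α ⟨u, hu⟩)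
    (hstrict : ∀ i : Fin n, (i : ℕ) < u → α ⟨u, hu⟩ < α i)
    (h2 : 2 ≤ α ⟨u, hu⟩)
    (N : ℕ) (hN : N = ∏ i, p i ^ α i) :
    {D : Finset ℕ | IsMaxNSet N D ∧
        D.card = α ⟨n - 1, by omega⟩ *
          ∏ i ∈ Finset.univ.erase ⟨n - 1, by omega⟩, (α i + 1)}.ncard = n - u := by
  have hN0 : N ≠ 0 := hN ▸ prod_ne_zero_iff.2 fun i _ => pow_ne_zero _ (hp i).ne_zero
  have hlast : α ⟨n - 1, by omega⟩ = α ⟨u, hu⟩ := hconst _ (by simp only; omega)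
  have hset : {D : Finset ℕ | IsMaxNSet N D ∧ D.card = α ⟨n - 1, by omega⟩ *
      ∏ i ∈ Finset.univ.erase ⟨n - 1, by omega⟩, (α i + 1)} =
      ((Finset.Ici (⟨u, hu⟩ : Fin n)).image fun i => RSet {p i} N : Finset (Finset ℕ)) := by
    ext D
    rw [Set.mem_ofPred_eq, hN, isMaxNSet_and_card_iff hp hinj (hlast ▸ h2)
      fun i => hanti i _ (Fin.le_def.2 (by have := i.2; simp only; omega)), hlast]
    simp only [coe_image, Set.mem_image, mem_coe, Finset.mem_Ici, Fin.le_def]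
    refine exists_congr fun i => and_congr_left fun _ => ⟨fun h => ?_, hconst i⟩
    by_contra hi
    exact (hstrict i (not_le.1 hi)).ne' h
  rw [hset, Set.ncard_coe_finset, card_image_of_injOn, Fin.card_Ici]
  intro i hi j _ h
  have hdvd : p i ∣ N := by
    rw [hN]
    refine (dvd_pow_self (p i) ?_).trans (dvd_prod_of_mem (fun i => p i ^ α i) (mem_univ i))
    have := hconst i (Fin.le_def.1 (Finset.mem_Ici.1 hi))
    omega
  have hmem : p i ∈ RSet {p j} N := by
    simpa only [← show RSet {p i} N = RSet {p j} N from h] using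
      (mem_RSet_singleton hN0).2 ⟨hdvd, dvd_rfl⟩
  exact hinj ((Nat.prime_dvd_prime_iff_eq (hp j) (hp i)).1
    ((mem_RSet_singleton hN0).1 hmem).2).symm
end

section
/- Let p_1, ..., p_n be distinct primes, let α_1 ≥ α_2 ≥ ... ≥ α_u > α_{u+1} = ... = α_n (with u = 0 if all α_i are equal), and let N = p_1^{α_1}···p_n^{α_n}. If D is a maximal N-set and {p_{u+1}, ..., p_n} ∩ D ≠ ∅, then d(D) = {p_v} for some v with u+1 ≤ v ≤ n. -/
open Finset

/-- **Lemma 1.** With `α₁ ≥ ⋯ ≥ α_u > α_{u+1} = ⋯ = α_n` (0-indexed) and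
`N = p₁^{α₁} ⋯ p_n^{α_n}`: if `D` is a maximal `N`-set and
`{p_{u+1}, …, p_n} ∩ D ≠ ∅`, then `d(D) = {p_v}` for some `u+1 ≤ v ≤ n`. -/
theorem stmt_8 (n u : ℕ) (hu : u < n) (p α : Fin n → ℕ)
    (hp : ∀ i, (p i).Prime) (hinj : Function.Injective p)
    (hα : ∀ i, 1 ≤ α i)
    (hanti : ∀ i j : Fin n, i ≤ j → α j ≤ α i)
    (hconst : ∀ i : Fin n, u ≤ (i : ℕ) → α i = α ⟨u, hu⟩)
    (hstrict : ∀ i : Fin n, (i : ℕ) < u → α ⟨u, hu⟩ < α i)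
    (N : ℕ) (hN : N = ∏ i, p i ^ α i)
    (D : Finset ℕ) (hD : IsMaxNSet N D)
    (hmem : ∃ i : Fin n, u ≤ (i : ℕ) ∧ p i ∈ D) :
    ∃ v : Fin n, u ≤ (v : ℕ) ∧ dSet D = {p v} := by
  obtain ⟨⟨_, hgcd⟩, _⟩ := hD
  obtain ⟨v, hv, hvD⟩ := hmem
  have hdvd : ∀ d ∈ D, p v ∣ d := fun d hd => by
    by_contra h
    exact hgcd _ hvD d hd (((hp v).coprime_iff_not_dvd).2 h)
  refine ⟨v, hv, ?_⟩
  ext d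
  simp only [dSet, mem_filter, mem_singleton]
  constructor
  · rintro ⟨hd, hmin⟩
    exact (hmin _ hvD (hdvd d hd)).symm
  · rintro rfl
    exact ⟨hvD, fun e he hev => Nat.dvd_antisymm hev (hdvd e he)⟩
end

section
/- Let p_1, ..., p_n be distinct primes, let N' = p_1···p_n, and let A be a maximal N'-set. Then for every divisor d of N', exactly one of d and N'/d belongs to A. -/
open Finset

/-- **Lemma 2.** Let `N' = p₁ ⋯ p_n` (distinct primes) and let `A` be a maximal
`N'`-set. Then for every divisor `d` of `N'`, exactly one of `d` and `N'/d` belongs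
to `A`. -/
theorem stmt_9 (n : ℕ) (hn : 0 < n) (p : Fin n → ℕ)
    (hp : ∀ i, (p i).Prime) (hinj : Function.Injective p)
    (N' : ℕ) (hN' : N' = ∏ i, p i)
    (A : Finset ℕ) (hA : IsMaxNSet N' A) :
    ∀ d, d ∣ N' → (d ∈ A ↔ N' / d ∉ A) := by
  have hsq : Squarefree N' := by
    rw [hN']
    refine Finset.squarefree_prod_of_pairwise_isCoprime ?_ fun i _ => (hp i).prime.squarefree
    intro i _ j _ hij
    exact Nat.coprime_iff_isRelPrime.mp
      ((Nat.coprime_primes (hp i) (hp j)).mpr fun h => hij (hinj h))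
  rintro d ⟨e, rfl⟩
  have hd : 0 < d := Nat.pos_of_ne_zero fun h => hsq.ne_zero (by simp [h])
  rw [Nat.mul_div_cancel_left e hd]
  obtain ⟨⟨hdvd, hgcd⟩, hmax⟩ := hA
  refine ⟨fun hdA heA => hgcd d hdA e heA (Nat.coprime_of_squarefree_mul hsq), fun heA => ?_⟩
  by_contra hdA
  obtain ⟨a, haA, ha⟩ := hmax d (dvd_mul_right d e) hdA
  obtain ⟨b, hbA, hb⟩ := hmax e (dvd_mul_left e d) heA
  have hae : a ∣ e := (Nat.Coprime.symm ha).dvd_of_dvd_mul_left (hdvd a haA)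
  exact hgcd a haA b hbA (Nat.Coprime.coprime_dvd_left hae hb)
end

section
/- Let p_1, ..., p_n be distinct primes, let N' = p_1···p_n, and let A be a maximal N'-set. Set A_n = { d ∈ A : p_n ∣ d }, A_n' = { d ∈ A : p_n ∤ d }, and for d ∣ N' write d̄ = N'/d. Then A_n ∪ { d̄ : d ∈ A_n' } = { l·p_n : l ∣ p_1···p_{n-1} }. -/
open Finset

/-- A divisor of `N` missing from a maximal `N`-set has its complementary divisor in the set. -/
theorem IsMaxNSet.div_mem_s10 {N m : ℕ} {A : Finset ℕ} (hA : IsMaxNSet N A) (hN : 0 < N)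
    (hm : m ∣ N) (hmA : m ∉ A) : N / m ∈ A := by
  by_contra hc
  obtain ⟨d, hd, hmd⟩ := hA.2 m hm hmA
  obtain ⟨e, he, hce⟩ := hA.2 (N / m) (Nat.div_dvd_of_dvd hm) hc
  have hd' : d ∣ N / m := by
    have h : m * d ∣ N := Nat.Coprime.mul_dvd_of_dvd_of_dvd hmd hm (hA.1.1 d hd)
    rw [← Nat.mul_div_cancel' hm] at h
    exact Nat.dvd_of_mul_dvd_mul_left (Nat.pos_of_dvd_of_pos hm hN) h
  exact hA.1.2 d hd e he (Nat.Coprime.coprime_dvd_left hd' hce)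

/-- If `q` is a prime not dividing `M`, the elements of a maximal `M * q`-set divisible by `q`,
together with the complements of the others, are the multiples of `q` dividing `M * q`. -/
theorem IsMaxNSet.filter_union_image_div {M q : ℕ} {A : Finset ℕ} (hA : IsMaxNSet (M * q) A)
    (hM : 0 < M) (hq : q.Prime) (hqM : ¬ q ∣ M) :
    (A.filter fun d => q ∣ d) ∪ ((A.filter fun d => ¬ q ∣ d).image fun d => M * q / d) =
      M.divisors.image fun l => l * q := by
  ext x
  simp only [mem_union, mem_filter, mem_image, Nat.mem_divisors]
  constructor
  · rintro (⟨hx, l, rfl⟩ | ⟨d, ⟨hd, hqd⟩, rfl⟩)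
    · refine ⟨l, ⟨?_, hM.ne'⟩, mul_comm _ _⟩
      have h := hA.1.1 _ hx
      rw [mul_comm] at h
      exact Nat.dvd_of_mul_dvd_mul_right hq.pos h
    · have hdM : d ∣ M :=
        Nat.Coprime.dvd_of_dvd_mul_right ((hq.coprime_iff_not_dvd.2 hqd).symm) (hA.1.1 d hd)
      exact ⟨M / d, ⟨Nat.div_dvd_of_dvd hdM, hM.ne'⟩, (Nat.div_mul_right_comm hdM q)⟩
  · rintro ⟨l, ⟨hl, -⟩, rfl⟩
    have hN : 0 < M * q := Nat.mul_pos hM hq.pos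
    have hm : l * q ∣ M * q := Nat.mul_dvd_mul_right hl q
    by_cases h : l * q ∈ A
    · exact Or.inl ⟨h, dvd_mul_left _ _⟩
    · refine Or.inr ⟨M * q / (l * q), ⟨hA.div_mem_s10 hN hm h, ?_⟩, Nat.div_div_self hm hN.ne'⟩
      rw [Nat.mul_div_mul_right _ _ hq.pos]
      exact fun hd => hqM (hd.trans (Nat.div_dvd_of_dvd hl))

/-- **Lemma 3.** Let `N' = p₁ ⋯ p_n` (distinct primes), `A` a maximal `N'`-set,
`A_n = {d ∈ A : p_n ∣ d}`, `A_n' = {d ∈ A : p_n ∤ d}` and `d̄ = N'/d`. Then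
`A_n ∪ {d̄ : d ∈ A_n'} = {l·p_n : l ∣ p₁ ⋯ p_{n-1}}`. -/
theorem stmt_10 (n : ℕ) (hn : 0 < n) (p : Fin n → ℕ)
    (hp : ∀ i, (p i).Prime) (hinj : Function.Injective p)
    (N' : ℕ) (hN' : N' = ∏ i, p i)
    (A : Finset ℕ) (hA : IsMaxNSet N' A) :
    (A.filter fun d => p ⟨n - 1, by omega⟩ ∣ d) ∪
        ((A.filter fun d => ¬ p ⟨n - 1, by omega⟩ ∣ d).image fun d => N' / d) =
      (∏ i ∈ Finset.univ.erase ⟨n - 1, by omega⟩, p i).divisors.image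
        fun l => l * p ⟨n - 1, by omega⟩ := by
  subst hN'
  rw [← Finset.prod_erase_mul univ p (mem_univ (⟨n - 1, by omega⟩ : Fin n))] at hA ⊢
  refine hA.filter_union_image_div (Finset.prod_pos fun i _ => (hp i).pos) (hp _) fun h => ?_
  obtain ⟨i, hi, hdvd⟩ := (hp _).prime.exists_mem_finset_dvd h
  exact (mem_erase.1 hi).1 (hinj ((Nat.prime_dvd_prime_iff_eq (hp _) (hp i)).1 hdvd).symm)
end

section
/- Let p_1, ..., p_n be distinct primes, N = p_1^{α_1}···p_n^{α_n} with α_1 ≥ ... ≥ α_n ≥ 1, and let D be a maximal N-set with |D| = α_n · ∏_{i=1}^{n-1} (α_i + 1). Let N' = p_1···p_n, A = { d : d ∣ N', d ∈ D }, A_n' = { d ∈ A : p_n ∤ d } = {d_1, ..., d_s}, d̄ = N'/d for d ∣ N', and α(d) = ∏_{p_i ∣ d} α_i. Then there exists a permutation i_1, ..., i_s of 1, ..., s such that for every j with 1 ≤ j ≤ s, d̄_{i_j} divides d_j·p_n and α(d_j) = α(d̄_{i_j}). -/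
open Finset

/-- A finite lower set of finsets has a permutation sending each member to a disjoint one. -/
lemma exists_injOn_disjoint_of_isLowerSet {ι : Type*} [DecidableEq ι] (𝒜 : Finset (Finset ι)) :
    IsLowerSet (𝒜 : Set (Finset ι)) →
      ∃ π : Finset ι → Finset ι, (∀ U ∈ 𝒜, π U ∈ 𝒜 ∧ Disjoint U (π U)) ∧
        Set.InjOn π 𝒜 := by
  induction 𝒜 using Finset.memberFamily_induction_on with
  | empty => exact fun _ => ⟨id, by simp, by simp⟩
  | singleton_empty => exact fun _ => ⟨id, by simp, by simp⟩
  | @subfamily a 𝒜 h₀ h₁ =>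
    intro h
    obtain ⟨π₀, m₀, i₀⟩ := h₀ h.nonMemberSubfamily
    obtain ⟨π₁, m₁, i₁⟩ := h₁ h.memberSubfamily
    have hsub : ∀ U, insert a U ∈ 𝒜 → U ∈ 𝒜 := fun U hU => h (subset_insert a U) hU
    simp only [mem_nonMemberSubfamily, mem_memberSubfamily] at m₀ m₁
    have j₀ : ∀ U V, U ∈ 𝒜 → a ∉ U → V ∈ 𝒜 → a ∉ V → π₀ U = π₀ V → U = V :=
      fun U V hU hU' hV hV' he => i₀ (by simp [*]) (by simp [*]) he
    have j₁ : ∀ U V, insert a U ∈ 𝒜 → a ∉ U → insert a V ∈ 𝒜 → a ∉ V → π₁ U = π₁ V → U = V :=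
      fun U V hU hU' hV hV' he => i₁ (by simp [*]) (by simp [*]) he
    have hrem : ∀ U ∈ 𝒜, a ∈ U → insert a (U.erase a) ∈ 𝒜 ∧ U.erase a ∈ 𝒜 := by
      intro U hU ha
      have := insert_erase ha
      exact ⟨by rwa [this], h (erase_subset a U) hU⟩
    refine ⟨fun U => if a ∈ U then π₀ (U.erase a) else
      if insert a U ∈ 𝒜 then insert a (π₁ U) else π₀ U, ?_, ?_⟩
    · intro U hU
      by_cases ha : a ∈ U
      · obtain ⟨⟨x, y⟩, z⟩ := m₀ (U.erase a) ⟨(hrem U hU ha).2, notMem_erase a U⟩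
        simp only [ha, if_true]
        refine ⟨x, ?_⟩
        have hd := disjoint_insert_left.2 ⟨y, z⟩
        rwa [insert_erase ha] at hd
      · by_cases hb : insert a U ∈ 𝒜
        · simp only [ha, hb, if_true, if_false]
          obtain ⟨⟨x, y⟩, z⟩ := m₁ U ⟨hb, ha⟩
          exact ⟨x, disjoint_insert_right.2 ⟨ha, z⟩⟩
        · simp only [ha, hb, if_false]
          obtain ⟨⟨x, y⟩, z⟩ := m₀ U ⟨hU, ha⟩
          exact ⟨x, z⟩
    · intro U hU V hV he
      have hU' : U ∈ 𝒜 := hU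
      have hV' : V ∈ 𝒜 := hV
      have e₀ : ∀ W, insert a W ∉ 𝒜 → ∀ U ∈ 𝒜, a ∈ U → W ∈ 𝒜 → a ∉ W →
          π₀ (U.erase a) ≠ π₀ W := by
        intro W hW U hU ha hW1 hW2 he
        have := j₀ _ _ (hrem U hU ha).2 (notMem_erase a U) hW1 hW2 he
        exact hW (this ▸ (hrem U hU ha).1)
      have e₁ : ∀ U V, U ∈ 𝒜 → a ∉ U → π₀ U ≠ insert a (π₁ V) := by
        intro U V hU ha he
        exact (m₀ U ⟨hU, ha⟩).1.2 (he ▸ mem_insert_self _ _)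
      by_cases ha : a ∈ U <;> by_cases hb : a ∈ V <;> simp only [ha, hb, if_true, if_false] at he
      · have := j₀ _ _ (hrem U hU ha).2 (notMem_erase a U) (hrem V hV hb).2 (notMem_erase a V) he
        rw [← insert_erase ha, ← insert_erase hb, this]
      · split_ifs at he with hc
        · exact absurd he (e₁ _ _ (hrem U hU ha).2 (notMem_erase a U))
        · exact absurd he (e₀ _ hc _ hU' ha hV' hb)
      · split_ifs at he with hc
        · exact absurd he.symm (e₁ _ _ (hrem V hV hb).2 (notMem_erase a V))
        · exact absurd he.symm (e₀ _ hc _ hV' hb hU' ha)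
      · split_ifs at he with hc hd hd
        · refine j₁ _ _ hc ha hd hb ?_
          rw [← erase_insert (m₁ U ⟨hc, ha⟩).1.2, he, erase_insert (m₁ V ⟨hd, hb⟩).1.2]
        · exact absurd he.symm (e₁ _ _ hV' hb)
        · exact absurd he (e₁ _ _ hU' ha)
        · exact j₀ _ _ hU' ha hV' hb he

/-- An intersecting upper set `F` containing a set or its complement, of weight at most that of the
star at a point `m` of minimum weight, has a weight-compatible injection on its members
avoiding `m`. -/
lemma exists_injOn_compl_subset_insert {ι : Type*} [Fintype ι] [DecidableEq ι] (α : ι → ℕ) (m : ι)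
    (hα : ∀ i, 1 ≤ α i) (hm : ∀ i, α m ≤ α i) (F : Finset (Finset ι))
    (hup : IsUpperSet (F : Set (Finset ι)))
    (hint : ∀ S ∈ F, ∀ T ∈ F, (S ∩ T).Nonempty) (hcompl : ∀ S, S ∉ F → Sᶜ ∈ F)
    (hsum : ∑ S ∈ F, ∏ i ∈ S, α i ≤ α m * ∏ i ∈ univ.erase m, (α i + 1)) :
    ∃ σ : Finset ι → Finset ι,
      (∀ S ∈ F, m ∉ S → σ S ∈ F ∧ m ∉ σ S ∧ (σ S)ᶜ ⊆ insert m S ∧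
        ∏ i ∈ S, α i = ∏ i ∈ (σ S)ᶜ, α i) ∧
      Set.InjOn σ {S | S ∈ F ∧ m ∉ S} := by
  set X : Finset ι := univ.erase m with hX
  set G := X.powerset.filter (fun U => X \ U ∈ F) with hG
  have memG : ∀ U, U ∈ G ↔ m ∉ U ∧ X \ U ∈ F := by
    intro U
    simp [hG, hX, subset_erase]
  have hlow : IsLowerSet (G : Set (Finset ι)) := by
    intro U V hVU hU
    rw [mem_coe, memG] at hU ⊢
    exact ⟨fun h => hU.1 (hVU h), hup (sdiff_subset_sdiff le_rfl hVU) hU.2⟩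
  obtain ⟨π, hπ, hinj⟩ := exists_injOn_disjoint_of_isLowerSet G hlow
  have hinv : ∀ U, m ∉ U → X \ (X \ U) = U := by
    intro U hU
    rw [Finset.sdiff_sdiff_eq_self]
    simp [hX, subset_erase, hU]
  have hcompl_sdiff : ∀ U, m ∉ U → (X \ U)ᶜ = insert m U := by
    intro U hU
    ext i
    simp only [hX, mem_compl, mem_sdiff, mem_erase, mem_univ, and_true, mem_insert]
    tauto
  have hbij : Set.BijOn π G G :=
    ⟨fun U hU => (hπ U hU).1, hinj,
      surjOn_of_injOn_of_card_le π (fun U hU => (hπ U hU).1) hinj le_rfl⟩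
  have hin : ∑ S ∈ F with m ∉ S, ∏ i ∈ S, α i = ∑ U ∈ G, ∏ i ∈ X \ U, α i := by
    refine sum_nbij' (fun S => X \ S) (fun U => X \ U) ?_ ?_ ?_ ?_ ?_
    · intro S hS
      rw [mem_filter] at hS
      rw [memG, hinv S hS.2]
      exact ⟨by simp [hX], hS.1⟩
    · intro U hU
      rw [memG] at hU
      exact mem_filter.2 ⟨hU.2, by simp [hX]⟩
    · intro S hS
      exact hinv S (mem_filter.1 hS).2
    · intro U hU
      exact hinv U ((memG U).1 hU).1
    · intro S hS
      rw [hinv S (mem_filter.1 hS).2]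
  have hout : ∑ S ∈ F with ¬ m ∉ S, ∏ i ∈ S, α i =
      ∑ U ∈ X.powerset with ¬ X \ U ∈ F, α m * ∏ i ∈ U, α i := by
    refine sum_nbij' (fun S => S.erase m) (fun U => insert m U) ?_ ?_ ?_ ?_ ?_
    · intro S hS
      rw [mem_filter, not_not] at hS
      refine mem_filter.2 ⟨by simp [hX, subset_erase], fun h => ?_⟩
      obtain ⟨i, hi⟩ := hint S hS.1 _ h
      simp only [hX, mem_inter, mem_sdiff, mem_erase, mem_univ, and_true] at hi
      exact hi.2.2 ⟨hi.2.1, hi.1⟩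
    · intro U hU
      simp only [mem_filter, mem_powerset, hX, subset_erase] at hU
      refine mem_filter.2 ⟨?_, by simp⟩
      rw [← hcompl_sdiff U hU.1.2]
      exact hcompl _ hU.2
    · intro S hS
      rw [mem_filter, not_not] at hS
      exact insert_erase hS.2
    · intro U hU
      simp only [mem_filter, mem_powerset, hX, subset_erase] at hU
      exact erase_insert hU.1.2
    · intro S hS
      rw [mem_filter, not_not] at hS
      exact (mul_prod_erase S α hS.2).symm
  have htot : α m * ∏ i ∈ X, (α i + 1) = ∑ U ∈ G, α m * ∏ i ∈ U, α i +
      ∑ U ∈ X.powerset with ¬ X \ U ∈ F, α m * ∏ i ∈ U, α i := by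
    rw [hG, sum_filter_add_sum_filter_not, prod_add_one, mul_sum]
  have hreindex : ∑ U ∈ G, α m * ∏ i ∈ π U, α i = ∑ U ∈ G, α m * ∏ i ∈ U, α i :=
    sum_nbij π (fun U hU => (hπ U hU).1) hbij.injOn hbij.surjOn (fun _ _ => rfl)
  have hle : ∑ U ∈ G, ∏ i ∈ X \ U, α i ≤ ∑ U ∈ G, α m * ∏ i ∈ π U, α i := by
    rw [← sum_filter_add_sum_filter_not F (fun S => m ∉ S), hin, hout, htot] at hsum
    rw [hreindex]
    exact Nat.le_of_add_le_add_right hsum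
  have hpt : ∀ U ∈ G, α m * ∏ i ∈ π U, α i ≤ ∏ i ∈ X \ U, α i := by
    intro U hU
    obtain ⟨h1, h2⟩ := hπ U hU
    obtain ⟨i, hi⟩ := hint _ ((memG _).1 hU).2 _ ((memG _).1 h1).2
    simp only [mem_inter, mem_sdiff] at hi
    have hsub : insert i (π U) ⊆ X \ U := by
      intro j hj
      rcases mem_insert.1 hj with rfl | hj
      · exact mem_sdiff.2 hi.1
      · refine mem_sdiff.2 ⟨?_, fun h => disjoint_left.1 h2 h hj⟩
        simp only [hX, mem_erase, mem_univ, and_true]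
        rintro rfl
        exact ((memG _).1 h1).1 hj
    calc α m * ∏ i ∈ π U, α i ≤ α i * ∏ i ∈ π U, α i := Nat.mul_le_mul_right _ (hm i)
      _ = ∏ j ∈ insert i (π U), α j := (prod_insert hi.2.2).symm
      _ ≤ _ := prod_le_prod_of_subset_of_one_le' hsub fun j _ _ => hα j
  have heq := (sum_eq_sum_iff_of_le hpt).1 (le_antisymm (sum_le_sum hpt) hle)
  have hmem : ∀ S ∈ F, m ∉ S → X \ S ∈ G := by
    intro S hS hmS
    rw [memG, hinv S hmS]
    exact ⟨by simp [hX], hS⟩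
  refine ⟨fun S => X \ π (X \ S), ?_, ?_⟩
  · intro S hS hmS
    obtain ⟨h1, h2⟩ := hπ _ (hmem S hS hmS)
    have h3 := (memG _).1 h1
    have h4 := heq _ (hmem S hS hmS)
    rw [hinv S hmS] at h4
    refine ⟨h3.2, by simp [hX], ?_, ?_⟩
    · rw [hcompl_sdiff _ h3.1]
      refine insert_subset_insert m fun i hi => ?_
      by_contra hiS
      refine disjoint_right.1 h2 hi (mem_sdiff.2 ⟨?_, hiS⟩)
      simp only [hX, mem_erase, mem_univ, and_true]
      rintro rfl
      exact h3.1 hi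
    · rw [hcompl_sdiff _ h3.1, prod_insert h3.1, h4]
  · rintro S ⟨hS, hmS⟩ T ⟨hT, hmT⟩ he
    have hS' := hmem S hS hmS
    have hT' := hmem T hT hmT
    have he' : π (X \ S) = π (X \ T) := by
      rw [← hinv _ ((memG _).1 (hπ _ hS').1).1, ← hinv _ ((memG _).1 (hπ _ hT').1).1]
      exact congrArg (X \ ·) he
    rw [← hinv S hmS, ← hinv T hmT, hinj hS' hT' he']

lemma sum_prod_eq_card_filter_piFinset {ι : Type*} [Fintype ι] [DecidableEq ι] (α : ι → ℕ)
    (F : Finset (Finset ι)) :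
    ∑ S ∈ F, ∏ i ∈ S, α i =
      #{e ∈ Fintype.piFinset fun i => range (α i + 1) | ({i | e i ≠ 0} : Finset ι) ∈ F} := by
  rw [card_eq_sum_card_fiberwise (s := {e ∈ Fintype.piFinset fun i => range (α i + 1) |
      ({i | e i ≠ 0} : Finset ι) ∈ F}) (f := fun e : ι → ℕ => ({i | e i ≠ 0} : Finset ι)) (t := F)
    (fun e he => (mem_filter.1 (mem_coe.1 he)).2)]
  refine sum_congr rfl fun S hS => ?_
  have : ({e ∈ {e ∈ Fintype.piFinset fun i => range (α i + 1) |
      ({i | e i ≠ 0} : Finset ι) ∈ F} |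
      ({i | e i ≠ 0} : Finset ι) = S}) =
      Fintype.piFinset fun i => if i ∈ S then Icc 1 (α i) else {0} := by
    ext e
    simp only [mem_filter, Fintype.mem_piFinset]
    constructor
    · rintro ⟨⟨h, -⟩, rfl⟩ i
      have := h i
      simp only [mem_range, mem_filter, mem_univ, true_and] at this ⊢
      split_ifs with h0
      · rw [mem_Icc]; omega
      · simpa using h0
    · intro h
      have hSe : ({i | e i ≠ 0} : Finset ι) = S := by
        ext i
        have := h i
        simp only [mem_filter, mem_univ, true_and]
        split_ifs at this with h0
        · rw [mem_Icc] at this; simp only [h0, iff_true]; omega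
        · simpa [h0] using this
      refine ⟨⟨fun i => ?_, hSe ▸ hS⟩, hSe⟩
      have := h i
      split_ifs at this with h0
      · rw [mem_Icc] at this; rw [mem_range]; omega
      · simp only [mem_singleton] at this; simp [this]
  rw [this, Fintype.card_piFinset, ← prod_subset (subset_univ S)]
  · exact prod_congr rfl fun i hi => by simp [hi]
  · intro i _ hi
    simp [hi]

section PrimeFamily

variable {ι : Type*} {p : ι → ℕ}

lemma prime_dvd_prod_pow_iff (hp : ∀ i, (p i).Prime) (hinj : Function.Injective p)
    (s : Finset ι) (e : ι → ℕ) (i : ι) : p i ∣ ∏ j ∈ s, p j ^ e j ↔ i ∈ s ∧ e i ≠ 0 := by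
  rw [(hp i).prime.dvd_finsetProd_iff]
  constructor
  · rintro ⟨j, hj, hd⟩
    have hij := hinj ((Nat.prime_dvd_prime_iff_eq (hp i) (hp j)).1 ((hp i).dvd_of_dvd_pow hd))
    subst hij
    refine ⟨hj, fun h0 => (hp i).one_lt.ne' ?_⟩
    simpa [h0] using hd
  · rintro ⟨hi, h0⟩
    exact ⟨i, hi, dvd_pow_self _ h0⟩

lemma prime_dvd_prod_iff (hp : ∀ i, (p i).Prime) (hinj : Function.Injective p)
    (s : Finset ι) (i : ι) : p i ∣ ∏ j ∈ s, p j ↔ i ∈ s := by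
  simpa using prime_dvd_prod_pow_iff hp hinj s 1 i

lemma prod_pow_injective [Fintype ι] (hp : ∀ i, (p i).Prime) (hinj : Function.Injective p) :
    Function.Injective fun e : ι → ℕ => ∏ i, p i ^ e i := by
  have key : ∀ (e : ι → ℕ) i, (∏ j, p j ^ e j).factorization (p i) = e i := by
    intro e i
    rw [Nat.factorization_prod_apply (fun j _ => pow_ne_zero _ (hp j).ne_zero),
      sum_eq_single i]
    · simp [(hp i).factorization]
    · intro j _ hj
      simp [(hp j).factorization, hinj.ne hj]
    · simp
  intro e f h
  funext i
  rw [← key e i, ← key f i]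
  exact congrArg (fun x => x.factorization (p i)) h

lemma exists_prime_dvd_of_gcd_ne_one [Fintype ι] (hp : ∀ i, (p i).Prime) {α : ι → ℕ} {d e : ℕ}
    (hd : d ∣ ∏ i, p i ^ α i) (h : Nat.gcd d e ≠ 1) : ∃ i, p i ∣ d ∧ p i ∣ e := by
  obtain ⟨q, hq, hqd⟩ := Nat.exists_prime_and_dvd h
  have h1 := hqd.trans (Nat.gcd_dvd_left d e)
  obtain ⟨i, -, hi⟩ := (hq.prime.dvd_finsetProd_iff _).1 (h1.trans hd)
  have := (Nat.prime_dvd_prime_iff_eq hq (hp i)).1 (hq.dvd_of_dvd_pow hi)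
  subst this
  exact ⟨i, h1, hqd.trans (Nat.gcd_dvd_right d e)⟩

lemma eq_prod_filter_of_dvd_prod [Fintype ι] (hp : ∀ i, (p i).Prime) (hinj : Function.Injective p)
    {d : ℕ} (hd : d ∣ ∏ i, p i) : d = ∏ i with p i ∣ d, p i := by
  have h1 : ∏ i with p i ∣ d, p i ∣ d :=
    prod_dvd_of_isRelPrime
      (fun i _ j _ hij => Nat.coprime_iff_isRelPrime.1
        ((Nat.coprime_primes (hp i) (hp j)).2 (hinj.ne hij)))
      fun i hi => (mem_filter.1 hi).2
  refine Nat.dvd_antisymm ?_ h1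
  have h2 : Nat.Coprime d (∏ i with ¬ p i ∣ d, p i) :=
    Nat.Coprime.prod_right fun i hi =>
      ((Nat.Prime.coprime_iff_not_dvd (hp i)).2 (mem_filter.1 hi).2).symm
  rw [← prod_filter_mul_prod_filter_not univ (fun i => p i ∣ d)] at hd
  exact h2.dvd_of_dvd_mul_right hd

end PrimeFamily

/-- **Lemma 4.** Let `N = p₁^{α₁} ⋯ p_n^{α_n}` with `α₁ ≥ ⋯ ≥ α_n ≥ 1`, let `D` be a
maximal `N`-set of minimum size `α_n ∏_{i=1}^{n-1} (α_i + 1)`, let `N' = p₁ ⋯ p_n`,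
`A = {d ∣ N' : d ∈ D}`, `A_n' = {d ∈ A : p_n ∤ d}`, `d̄ = N'/d` and
`α(d) = ∏_{p_i ∣ d} α_i`. Then there is a permutation `σ` of `A_n'` such that for
every `d ∈ A_n'`, `σ(d)‾ ∣ d·p_n` and `α(d) = α(σ(d)‾)`. -/
theorem stmt_11 (n : ℕ) (hn : 0 < n) (p α : Fin n → ℕ)
    (hp : ∀ i, (p i).Prime) (hinj : Function.Injective p)
    (hα : ∀ i, 1 ≤ α i)
    (hanti : ∀ i j : Fin n, i ≤ j → α j ≤ α i)
    (N : ℕ) (hN : N = ∏ i, p i ^ α i)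
    (N' : ℕ) (hN' : N' = ∏ i, p i)
    (D : Finset ℕ) (hD : IsMaxNSet N D)
    (hcard : D.card = α ⟨n - 1, by omega⟩ *
      ∏ i ∈ Finset.univ.erase ⟨n - 1, by omega⟩, (α i + 1))
    (An' : Finset ℕ)
    (hAn' : An' = D.filter fun d => d ∣ N' ∧ ¬ p ⟨n - 1, by omega⟩ ∣ d)
    (αf : ℕ → ℕ)
    (hαf : ∀ d, αf d = ∏ i ∈ Finset.univ.filter (fun i : Fin n => p i ∣ d), α i) :
    ∃ σ : ℕ → ℕ, Set.BijOn σ ↑An' ↑An' ∧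
      ∀ d ∈ An', (N' / σ d) ∣ d * p ⟨n - 1, by omega⟩ ∧ αf d = αf (N' / σ d) := by
  set m : Fin n := ⟨n - 1, by omega⟩
  have hmmin : ∀ i, α m ≤ α i := fun i =>
    hanti i m (Fin.le_def.2 (Nat.le_sub_one_of_lt i.isLt))
  let P : Finset (Fin n) → ℕ := fun S => ∏ i ∈ S, p i
  have hPdvd : ∀ S i, p i ∣ P S ↔ i ∈ S := prime_dvd_prod_iff hp hinj
  have hP0 : ∀ S, P S ≠ 0 := fun S => prod_ne_zero_iff.2 fun i _ => (hp i).ne_zero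
  have hPsub : ∀ S T, S ⊆ T → P S ∣ P T := fun S T h => prod_dvd_prod_of_subset _ _ _ h
  have hPN' : ∀ S, P S ∣ N' := fun S => hN' ▸ hPsub S univ (subset_univ S)
  have hN'N : N' ∣ N := by
    rw [hN, hN']
    exact prod_dvd_prod_of_dvd _ _ fun i _ => dvd_pow_self _ (Nat.one_le_iff_ne_zero.1 (hα i))
  have hPN : ∀ S, P S ∣ N := fun S => (hPN' S).trans hN'N
  have hPcompl : ∀ S, N' / P S = P Sᶜ := by
    intro S
    refine Nat.div_eq_of_eq_mul_right (Nat.pos_of_ne_zero (hP0 S)) ?_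
    rw [hN']
    exact (prod_mul_prod_compl S p).symm
  have hαP : ∀ S, αf (P S) = ∏ i ∈ S, α i := by
    intro S
    rw [hαf]
    exact prod_congr (by ext i; simp [hPdvd]) fun _ _ => rfl
  have hPeq : ∀ d, d ∣ N' → P (univ.filter fun i => p i ∣ d) = d := fun d hd =>
    (eq_prod_filter_of_dvd_prod hp hinj (hN' ▸ hd)).symm
  obtain ⟨⟨hDN, hDgcd⟩, hDmax⟩ := hD
  have hcommon : ∀ d ∈ D, ∀ e ∈ D, ∃ i, p i ∣ d ∧ p i ∣ e := fun d hd e he =>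
    exists_prime_dvd_of_gcd_ne_one hp (hN ▸ hDN d hd) (hDgcd d hd e he)
  have hnotcop : ∀ {d e : ℕ} {i}, p i ∣ d → p i ∣ e → Nat.gcd d e ≠ 1 := fun hd he =>
    Nat.not_coprime_of_dvd_of_dvd (hp _).one_lt hd he
  have hDup : ∀ d ∈ D, ∀ l, l ∣ N → (∀ i, p i ∣ d → p i ∣ l) → l ∈ D := by
    intro d hd l hl h
    by_contra hlD
    obtain ⟨e, he, hle⟩ := hDmax l hl hlD
    obtain ⟨i, hi, hi'⟩ := hcommon d hd e he
    exact hnotcop (h i hi) hi' hle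
  let F : Finset (Finset (Fin n)) := univ.filter fun S => P S ∈ D
  have memF : ∀ S, S ∈ F ↔ P S ∈ D := by simp [F]
  have hsum : ∑ S ∈ F, ∏ i ∈ S, α i ≤ D.card := by
    rw [sum_prod_eq_card_filter_piFinset]
    refine card_le_card_of_injOn (fun e => ∏ i, p i ^ e i) ?_ (prod_pow_injective hp hinj).injOn
    intro e he
    obtain ⟨he1, he2⟩ := mem_filter.1 (mem_coe.1 he)
    refine hDup _ ((memF _).1 he2) _ ?_ fun i hi => ?_
    · rw [hN]
      exact prod_dvd_prod_of_dvd _ _ fun i _ =>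
        pow_dvd_pow _ (Nat.lt_succ_iff.1 (mem_range.1 (Fintype.mem_piFinset.1 he1 i)))
    · rw [hPdvd, mem_filter] at hi
      exact (prime_dvd_prod_pow_iff hp hinj univ e i).2 hi
  obtain ⟨σ, hσ, hσinj⟩ := exists_injOn_compl_subset_insert α m hα hmmin F
    (fun S T hST hS => (memF T).2 <| hDup _ ((memF S).1 hS) _ (hPN T) fun i hi =>
      hi.trans (hPsub S T hST))
    (fun S hS T hT => by
      obtain ⟨i, hi, hi'⟩ := hcommon _ ((memF S).1 hS) _ ((memF T).1 hT)
      exact ⟨i, mem_inter.2 ⟨(hPdvd _ _).1 hi, (hPdvd _ _).1 hi'⟩⟩)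
    (fun S hS => by
      rw [memF] at hS
      obtain ⟨d, hd, hSd⟩ := hDmax _ (hPN S) hS
      refine (memF _).2 (hDup d hd _ (hPN _) fun i hi => ?_)
      rw [hPdvd, mem_compl, ← hPdvd]
      exact fun h => hnotcop h hi hSd)
    (hsum.trans hcard.le)
  let supp : ℕ → Finset (Fin n) := fun d => univ.filter fun i => p i ∣ d
  have hmem : ∀ d ∈ An', P (supp d) = d ∧ supp d ∈ F ∧ m ∉ supp d := by
    intro d hd
    rw [hAn', mem_filter] at hd
    have h := hPeq d hd.2.1
    refine ⟨h, (memF _).2 (h.symm ▸ hd.1), ?_⟩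
    simpa [supp] using hd.2.2
  have hmaps : ∀ d ∈ An', P (σ (supp d)) ∈ An' := by
    intro d hd
    obtain ⟨-, h2, h3⟩ := hmem d hd
    obtain ⟨h4, h5, -⟩ := hσ _ h2 h3
    rw [hAn', mem_filter]
    exact ⟨(memF _).1 h4, hPN' _, fun h => h5 ((hPdvd _ _).1 h)⟩
  have hPinj : Function.Injective P := fun S T h => by
    ext i
    rw [← hPdvd, h, hPdvd]
  have hinjOn : Set.InjOn (fun d => P (σ (supp d))) An' := by
    intro d hd e he h
    obtain ⟨h1, h2, h3⟩ := hmem d hd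
    obtain ⟨k1, k2, k3⟩ := hmem e he
    rw [← h1, ← k1, hσinj ⟨h2, h3⟩ ⟨k2, k3⟩ (hPinj h)]
  refine ⟨fun d => P (σ (supp d)),
    ⟨hmaps, hinjOn, surjOn_of_injOn_of_card_le _ hmaps hinjOn le_rfl⟩, ?_⟩
  intro d hd
  obtain ⟨h1, h2, h3⟩ := hmem d hd
  obtain ⟨-, -, h6, h7⟩ := hσ _ h2 h3
  refine ⟨?_, ?_⟩
  · have : d * p m = P (insert m (supp d)) := by
      have hins : P (insert m (supp d)) = p m * P (supp d) := prod_insert h3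
      rw [hins, h1, mul_comm]
    rw [this]
    simp only [hPcompl]
    exact hPsub _ _ h6
  · simp only [hPcompl, hαP]
    rw [← h7, ← hαP, h1]
end
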